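/- arXiv:math/0607639 — 5 statements merged into one kernel-verified Lean document; each statement's English description precedes it below -/
import Mathlib

section
/- Let R be a commutative ring, F a free R-module of rank f with orientation ω_F ∈ ⋀^f F, and let b_r ∈ ⋀^r F, α_q ∈ ⋀^q F*. Then for any b'_f ∈ ⋀^f F, the contraction [b_r(α_q)](b'_f) equals b_r ∧ α_q(b'_f), where α(b) denotes the module action of ⋀^• F* on ⋀^• F (contraction) and b(α) the action of ⋀^• F on ⋀^• F*. -/
/- Contraction infrastructure: the exterior algebra of the dual module acts on the
exterior algebra by (left) contraction, and vice versa. -/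

noncomputable section

open ExteriorAlgebra

variable (R : Type*) [CommRing R] (M : Type*) [AddCommGroup M] [Module R M]

/-- The action of `⋀ M*` on `⋀ M` by contraction (interior product): for `α ∈ ⋀^i M*` and
`b ∈ ⋀^j M`, `interiorL R M α b` is the element `α(b) ∈ ⋀^{j-i} M` of (1.1). -/
def interiorL : ExteriorAlgebra R (Module.Dual R M) →ₐ[R] Module.End R (ExteriorAlgebra R M) :=
  ExteriorAlgebra.lift R
    ⟨(CliffordAlgebra.contractLeft :
        Module.Dual R M →ₗ[R] Module.End R (ExteriorAlgebra R M)),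
      fun d => LinearMap.ext fun x => by
        simpa using CliffordAlgebra.contractLeft_contractLeft (d := d) x⟩

/-- The action of `⋀ M` on `⋀ M*` by contraction: for `b ∈ ⋀^j M` and `α ∈ ⋀^i M*`,
`interiorR R M b α` is the element `b(α) ∈ ⋀^{i-j} M*` of (1.1). -/
def interiorR :
    ExteriorAlgebra R M →ₐ[R] Module.End R (ExteriorAlgebra R (Module.Dual R M)) :=
  ExteriorAlgebra.lift R
    ⟨((CliffordAlgebra.contractLeft :
          Module.Dual R (Module.Dual R M) →ₗ[R]
            Module.End R (ExteriorAlgebra R (Module.Dual R M))) ∘ₗ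
        Module.Dual.eval R M),
      fun m => LinearMap.ext fun x => by
        simpa using
          CliffordAlgebra.contractLeft_contractLeft (d := Module.Dual.eval R M m) x⟩

lemma aux_wedge {R : Type*} [CommRing R] {F : Type*} [AddCommGroup F] [Module R F]
    [Module.Free R F] [Module.Finite R F] (m : F)
    (b' : ExteriorAlgebra R F) (hb' : b' ∈ ⋀[R]^(Module.finrank R F) F) :
    ExteriorAlgebra.ι R m * b' = 0 := by
  rcases subsingleton_or_nontrivial R with hR | hR
  · have : Subsingleton (ExteriorAlgebra R F) := Module.subsingleton R _
    exact Subsingleton.elim _ _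
  have h : ExteriorAlgebra.ι R m * b' ∈ ⋀[R]^(Module.finrank R F + 1) F := by
    rw [exteriorPower, pow_succ']
    exact Submodule.mul_mem_mul (LinearMap.mem_range_self _ m) hb'
  have h0 : Module.finrank R (⋀[R]^(Module.finrank R F + 1) F) = 0 := by
    rw [exteriorPower.finrank_eq]
    exact Nat.choose_eq_zero_of_lt (Nat.lt_succ_self _)
  have hs : Subsingleton (⋀[R]^(Module.finrank R F + 1) F) :=
    Module.finrank_eq_zero_iff_of_free R _ |>.1 h0
  exact congrArg Subtype.val (hs.elim ⟨_, h⟩ 0)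

lemma interiorL_ι {R : Type*} [CommRing R] {F : Type*} [AddCommGroup F] [Module R F]
    (d : Module.Dual R F) (x : ExteriorAlgebra R F) :
    interiorL R F (ExteriorAlgebra.ι R d) x = CliffordAlgebra.contractLeft d x := by
  simp [interiorL]

lemma interiorR_ι {R : Type*} [CommRing R] {F : Type*} [AddCommGroup F] [Module R F]
    (m : F) (x : ExteriorAlgebra R (Module.Dual R F)) :
    interiorR R F (ExteriorAlgebra.ι R m) x =
      CliffordAlgebra.contractLeft (Module.Dual.eval R F m) x := by
  simp [interiorR]

lemma aux_comm {R : Type*} [CommRing R] {F : Type*} [AddCommGroup F] [Module R F]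
    (m : F) (α : ExteriorAlgebra R (Module.Dual R F)) (x : ExteriorAlgebra R F) :
    interiorL R F (CliffordAlgebra.contractLeft (Module.Dual.eval R F m) α) x =
      ExteriorAlgebra.ι R m * interiorL R F α x
        - interiorL R F (CliffordAlgebra.involute α) (ExteriorAlgebra.ι R m * x) := by
  induction α using CliffordAlgebra.left_induction with
  | algebraMap r =>
    have h0 : interiorL R F (0 : ExteriorAlgebra R (Module.Dual R F)) x = 0 := by
      rw [map_zero, LinearMap.zero_apply]
    have h1 : ∀ y, interiorL R F
        (algebraMap R (ExteriorAlgebra R (Module.Dual R F)) r) y = r • y := by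
      intro y
      rw [AlgHom.commutes, Module.algebraMap_end_apply]
    rw [CliffordAlgebra.contractLeft_algebraMap, AlgHom.commutes CliffordAlgebra.involute]
    refine h0.trans ?_
    erw [h1, h1]
    rw [mul_smul_comm, sub_self]
  | add a b ha hb =>
    simp only [map_add, LinearMap.add_apply, ha, hb, mul_add]
    abel
  | ι_mul a d ha =>
    have h1 : CliffordAlgebra.involute (CliffordAlgebra.ι (0 : QuadraticForm R (Module.Dual R F)) d * a)
        = -(CliffordAlgebra.ι (0 : QuadraticForm R (Module.Dual R F)) d *
          CliffordAlgebra.involute a) := by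
      rw [map_mul, CliffordAlgebra.involute_ι, neg_mul]
    have h2 : ∀ (c : ExteriorAlgebra R (Module.Dual R F)) y,
        interiorL R F (CliffordAlgebra.ι (0 : QuadraticForm R (Module.Dual R F)) d * c) y
          = CliffordAlgebra.contractLeft d (interiorL R F c y) := by
      intro c y
      rw [map_mul, Module.End.mul_apply]
      exact interiorL_ι d _
    have h3 : ∀ (c : ExteriorAlgebra R (Module.Dual R F)) y,
        interiorL R F (-c) y = - interiorL R F c y := by
      intro c y
      rw [map_neg, LinearMap.neg_apply]
    have key : CliffordAlgebra.contractLeft d (ExteriorAlgebra.ι R m * interiorL R F a x)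
        = d m • interiorL R F a x
          - ExteriorAlgebra.ι R m * CliffordAlgebra.contractLeft d (interiorL R F a x) :=
      CliffordAlgebra.contractLeft_ι_mul (Q := (0 : QuadraticForm R F)) (d := d) m _
    rw [CliffordAlgebra.contractLeft_ι_mul, map_sub, map_smul, LinearMap.sub_apply,
      LinearMap.smul_apply, h1, h2, h2, ha, map_sub, key]
    erw [h3, h2]
    rw [Module.Dual.eval_apply]
    abel

theorem stmt_2 {R : Type*} [CommRing R] {F : Type*} [AddCommGroup F] [Module R F]
    [Module.Free R F] [Module.Finite R F] (f r q : ℕ)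
    (hf : Module.finrank R F = f)
    (b : ExteriorAlgebra R F) (hb : b ∈ ⋀[R]^r F)
    (α : ExteriorAlgebra R (Module.Dual R F)) (hα : α ∈ ⋀[R]^q (Module.Dual R F))
    (b' : ExteriorAlgebra R F) (hb' : b' ∈ ⋀[R]^f F) :
    interiorL R F (interiorR R F b α) b' = b * interiorL R F α b' := by
  subst hf
  clear hb hα
  induction b using CliffordAlgebra.left_induction with
  | algebraMap r =>
    erw [AlgHom.commutes]
    simp [Module.algebraMap_end_apply, Algebra.smul_def]
  | add a b ha hb =>
    simp only [map_add, LinearMap.add_apply, ha, hb, add_mul]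
  | ι_mul a m ha =>
    have e := interiorR_ι (R := R) (F := F) m
    have k := aux_comm m (interiorR R F a α) b'
    rw [aux_wedge m b' hb', map_zero, sub_zero, ha, ← e] at k
    rw [map_mul, Module.End.mul_apply, mul_assoc]
    exact k

end
end

section
/- Let R be a commutative ring, E, F, G free modules of ranks 1, f = g+1, g respectively, with maps V : E → F and X : F → G and element 𝔟 ∈ R (so e = 1, v = V(1) ∈ F). Define for each i the map A_i : ⋀^i G* → ⋀^i F* by A_i = ⋀^i X* and B_i : ⋀^i F* → ⋀^{i-1} G* by B_i(α_i) = [(⋀^{f-i} X)(α_i(ω_F))](ω_{G*}). Then the modules P_i = ⋀^i G* ⊕ ⋀^i F* ⊕ ⋀^{i-1} G* with differential given by the 3×3 matrix with rows [X(v), B_i, (-1)^{i+1}𝔟], [0, -v, A_{i-1}], [0, 0, X(v)] (where X(v) ∈ G acts by contraction on ⋀^• G* and v ∈ F acts by contraction on ⋀^• F*) form a complex, i.e., d_{i-1} ∘ d_i = 0 for all i. -/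
set_option synthInstance.maxHeartbeats 1000000
set_option maxHeartbeats 1000000

noncomputable section

open ExteriorAlgebra

variable (R : Type*) [CommRing R] (M : Type*) [AddCommGroup M] [Module R M]

/-- Model of `⋀ G*` for `G` free of rank `g`. -/
abbrev LG (R : Type*) [CommRing R] (g : ℕ) :=
  ExteriorAlgebra R (Module.Dual R (Fin g → R))

/-- Model of `⋀ F*` for `F` free of rank `f = g + 1`. -/
abbrev LF (R : Type*) [CommRing R] (g : ℕ) :=
  ExteriorAlgebra R (Module.Dual R (Fin (g + 1) → R))

/-- The (ungraded) module underlying each `P_i = ⋀^i G* ⊕ ⋀^i F* ⊕ ⋀^{i-1} G*`. -/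
abbrev PM (R : Type*) [CommRing R] (g : ℕ) := LG R g × LF R g × LG R g

variable (g : ℕ) (𝔟 : R) (v : Fin (g + 1) → R) (X : Matrix (Fin g) (Fin (g + 1)) R)

/-- Contraction of `⋀ G*` by `X(v) ∈ G`. -/
def cXv : Module.End R (LG R g) :=
  CliffordAlgebra.contractLeft (Q := (0 : QuadraticForm R (Module.Dual R (Fin g → R))))
    (Module.Dual.eval R (Fin g → R) (Matrix.toLin' X v))

/-- Contraction of `⋀ F*` by `v ∈ F`. -/
def cv : Module.End R (LF R g) :=
  CliffordAlgebra.contractLeft (Q := (0 : QuadraticForm R (Module.Dual R (Fin (g + 1) → R))))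
    (Module.Dual.eval R (Fin (g + 1) → R) v)

/-- `A = ⋀ X* : ⋀ G* → ⋀ F*` (on the degree-`i` piece this is `A_i = ⋀^i X*`). -/
def Amap : LG R g →ₗ[R] LF R g :=
  (ExteriorAlgebra.map (Matrix.toLin' X).dualMap).toLinearMap

/-- The orientation `ω_F = f_1 ∧ ⋯ ∧ f_{g+1} ∈ ⋀^{g+1} F`. -/
def omegaF : ExteriorAlgebra R (Fin (g + 1) → R) :=
  ExteriorAlgebra.ιMulti R (g + 1) fun j => Pi.single j 1

/-- The orientation `ω_{G*} = γ_1 ∧ ⋯ ∧ γ_g ∈ ⋀^g G*`. -/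
def omegaGd : LG R g :=
  ExteriorAlgebra.ιMulti R g fun i => (Pi.basisFun R (Fin g)).coord i

/-- `B(α) = [(⋀ X)(α(ω_F))](ω_{G*})` (on the degree-`i` piece this is
`B_i : ⋀^i F* → ⋀^{i-1} G*`). -/
def Bmap : LF R g →ₗ[R] LG R g :=
  (LinearMap.applyₗ (omegaGd R g)) ∘ₗ (interiorR R (Fin g → R)).toLinearMap ∘ₗ
    (ExteriorAlgebra.map (Matrix.toLin' X)).toLinearMap ∘ₗ
    (LinearMap.applyₗ (omegaF R g)) ∘ₗ (interiorL R (Fin (g + 1) → R)).toLinearMap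

/-- Projections of `PM` onto its three factors. -/
def pr1 : PM R g →ₗ[R] LG R g := LinearMap.fst R (LG R g) (LF R g × LG R g)

def pr2 : PM R g →ₗ[R] LF R g :=
  (LinearMap.fst R (LF R g) (LG R g)) ∘ₗ (LinearMap.snd R (LG R g) (LF R g × LG R g))

def pr3 : PM R g →ₗ[R] LG R g :=
  (LinearMap.snd R (LF R g) (LG R g)) ∘ₗ (LinearMap.snd R (LG R g) (LF R g × LG R g))

/-- The differential `d_i` of the complex `P` of Definition 3.3, given by the matrix
`[[X(v), B_i, (-1)^{i+1} 𝔟], [0, -v, A_{i-1}], [0, 0, X(v)]]`. -/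
def dP (i : ℕ) : PM R g →ₗ[R] PM R g :=
  ((cXv R g v X) ∘ₗ pr1 R g + (Bmap R g X) ∘ₗ pr2 R g +
      (((-1 : R) ^ (i + 1) * 𝔟) • pr3 R g)).prod
    (((-(cv R g v)) ∘ₗ pr2 R g + (Amap R g X) ∘ₗ pr3 R g).prod
      ((cXv R g v X) ∘ₗ pr3 R g))




theorem aux_map_contract {M N : Type*} [AddCommGroup M] [Module R M] [AddCommGroup N] [Module R N]
    (f : M →ₗ[R] N) (d : Module.Dual R N) (x : ExteriorAlgebra R M) :
    CliffordAlgebra.contractLeft (Q := (0 : QuadraticForm R N)) d (ExteriorAlgebra.map f x) =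
      ExteriorAlgebra.map f
        (CliffordAlgebra.contractLeft (Q := (0 : QuadraticForm R M)) (d ∘ₗ f) x) := by
  induction x using CliffordAlgebra.left_induction with
  | algebraMap r =>
    rw [CliffordAlgebra.contractLeft_algebraMap, map_zero]
    erw [AlgHom.commutes]
    exact CliffordAlgebra.contractLeft_algebraMap _ _ _
  | add x y hx hy => simp only [map_add, hx, hy]
  | ι_mul x m hx =>
    have h1 : ExteriorAlgebra.map f (CliffordAlgebra.ι (0 : QuadraticForm R M) m * x) =
        CliffordAlgebra.ι (0 : QuadraticForm R N) (f m) * ExteriorAlgebra.map f x := by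
      rw [map_mul]; congr 1; exact ExteriorAlgebra.map_apply_ι f m
    rw [h1, CliffordAlgebra.contractLeft_ι_mul, CliffordAlgebra.contractLeft_ι_mul, hx, map_sub,
      map_smul, map_mul]
    congr 2
    exact (ExteriorAlgebra.map_apply_ι f m).symm

theorem aux_interiorL_ι (a : Module.Dual R M) (x : ExteriorAlgebra R (Module.Dual R M))
    (y : ExteriorAlgebra R M) :
    interiorL R M (CliffordAlgebra.ι (0 : QuadraticForm R (Module.Dual R M)) a * x) y =
      CliffordAlgebra.contractLeft (Q := (0 : QuadraticForm R M)) a (interiorL R M x y) := by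
  rw [map_mul, Module.End.mul_apply]
  congr 1
  exact ExteriorAlgebra.lift_ι_apply R _ _ _

theorem aux_interiorR_ι (a : M) (x : ExteriorAlgebra R M)
    (y : ExteriorAlgebra R (Module.Dual R M)) :
    interiorR R M (ExteriorAlgebra.ι R a * x) y =
      CliffordAlgebra.contractLeft (Q := (0 : QuadraticForm R (Module.Dual R M)))
        (Module.Dual.eval R M a) (interiorR R M x y) := by
  rw [map_mul, Module.End.mul_apply]
  congr 1
  exact ExteriorAlgebra.lift_ι_apply R _ _ _

theorem aux_nat {M N : Type*} [AddCommGroup M] [Module R M] [AddCommGroup N] [Module R N]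
    (f : M →ₗ[R] N) (c : ExteriorAlgebra R (Module.Dual R N)) (y : ExteriorAlgebra R M) :
    ExteriorAlgebra.map f (interiorL R M (ExteriorAlgebra.map f.dualMap c) y) =
      interiorL R N c (ExteriorAlgebra.map f y) := by
  induction c using CliffordAlgebra.left_induction with
  | algebraMap r =>
    erw [AlgHom.commutes, AlgHom.commutes, AlgHom.commutes]
    simp [Module.algebraMap_end_apply]
  | add x y hx hy => simp only [map_add, LinearMap.add_apply, hx, hy]
  | ι_mul x m hx =>
    have h1 : ExteriorAlgebra.map f.dualMap
          (CliffordAlgebra.ι (0 : QuadraticForm R (Module.Dual R N)) m * x) =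
        CliffordAlgebra.ι (0 : QuadraticForm R (Module.Dual R M)) (f.dualMap m) *
          ExteriorAlgebra.map f.dualMap x := by
      rw [map_mul]; congr 1; exact ExteriorAlgebra.map_apply_ι f.dualMap m
    rw [h1, aux_interiorL_ι, aux_interiorL_ι, ← hx, aux_map_contract]
    rfl

theorem aux_leib (v : M) (c : ExteriorAlgebra R (Module.Dual R M)) (y : ExteriorAlgebra R M) :
    CliffordAlgebra.ι (0 : QuadraticForm R M) v * interiorL R M c y =
      interiorL R M (CliffordAlgebra.contractLeft (Q := (0 : QuadraticForm R (Module.Dual R M)))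
        (Module.Dual.eval R M v) c) y +
      interiorL R M (CliffordAlgebra.involute c)
        (CliffordAlgebra.ι (0 : QuadraticForm R M) v * y) := by
  induction c using CliffordAlgebra.left_induction with
  | algebraMap r =>
    have h0 : interiorL R M (algebraMap R (CliffordAlgebra
        (0 : QuadraticForm R (Module.Dual R M))) r) = algebraMap R _ r :=
      (interiorL R M).commutes r
    rw [CliffordAlgebra.contractLeft_algebraMap, map_zero, LinearMap.zero_apply, zero_add,
      AlgHom.commutes CliffordAlgebra.involute, h0]
    simp [Module.algebraMap_end_apply]
  | add x y hx hy => simp only [map_add, LinearMap.add_apply, mul_add, hx, hy]; abel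
  | ι_mul x m hx =>
    rw [CliffordAlgebra.contractLeft_ι_mul, map_mul CliffordAlgebra.involute, CliffordAlgebra.involute_ι, neg_mul,
      map_neg, LinearMap.neg_apply, aux_interiorL_ι, aux_interiorL_ι, map_sub, map_smul,
      LinearMap.sub_apply, LinearMap.smul_apply, aux_interiorL_ι]
    have h2 := congrArg (CliffordAlgebra.contractLeft (Q := (0 : QuadraticForm R M)) m) hx
    rw [CliffordAlgebra.contractLeft_ι_mul, map_add] at h2
    rw [Module.Dual.eval_apply]
    rw [sub_eq_iff_eq_add] at h2
    rw [h2]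
    abel

theorem aux_ιMulti_zero (n m : ℕ) (h : n < m) (w : Fin m → (Fin n → R)) :
    ExteriorAlgebra.ιMulti R m w = 0 := by
  have : (ExteriorAlgebra.ιMulti R m : (Fin n → R) [⋀^Fin m]→ₗ[R] _) = 0 := by
    refine Module.Basis.ext_alternating (Pi.basisFun R (Fin n)) ?_
    intro u hu
    have := Fintype.card_le_of_injective u hu
    simp at this
    omega
  rw [this]; rfl

theorem aux_vomega :
    CliffordAlgebra.ι (0 : QuadraticForm R (Fin (g + 1) → R)) v * omegaF R g = 0 := by
  have h := aux_ιMulti_zero R (g + 1) (g + 2) (by omega)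
    (Matrix.vecCons v (fun j => Pi.single j 1))
  rw [ExteriorAlgebra.ιMulti_succ_apply] at h
  exact h

theorem aux_Xomega : ExteriorAlgebra.map (Matrix.toLin' X) (omegaF R g) = 0 := by
  rw [omegaF, ExteriorAlgebra.map_apply_ιMulti]
  exact aux_ιMulti_zero R g (g + 1) (by omega) _

theorem aux_BA (c : LG R g) : Bmap R g X (Amap R g X c) = 0 := by
  have h := aux_nat R (Matrix.toLin' X) c (omegaF R g)
  rw [aux_Xomega, map_zero] at h
  change interiorR R (Fin g → R) (ExteriorAlgebra.map (Matrix.toLin' X)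
    (interiorL R (Fin (g+1) → R) (ExteriorAlgebra.map (Matrix.toLin' X).dualMap c)
      (omegaF R g))) (omegaGd R g) = 0
  rw [h, map_zero, LinearMap.zero_apply]

theorem aux_XB (c : LF R g) : cXv R g v X (Bmap R g X c) = Bmap R g X (cv R g v c) := by
  have h := aux_leib R _ v c (omegaF R g)
  rw [aux_vomega, map_zero, add_zero] at h
  change _ = interiorR R (Fin g → R) (ExteriorAlgebra.map (Matrix.toLin' X)
    (interiorL R (Fin (g+1) → R) (CliffordAlgebra.contractLeft
      (Q := (0 : QuadraticForm R (Module.Dual R (Fin (g+1) → R))))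
        (Module.Dual.eval R _ v) c) (omegaF R g))) (omegaGd R g)
  rw [← h, map_mul]
  have h3 : ExteriorAlgebra.map (Matrix.toLin' X)
    (CliffordAlgebra.ι (0 : QuadraticForm R (Fin (g + 1) → R)) v) =
      ExteriorAlgebra.ι R (Matrix.toLin' X v) := ExteriorAlgebra.map_apply_ι _ v
  rw [h3, aux_interiorR_ι]
  rfl

theorem aux_vA (c : LG R g) : cv R g v (Amap R g X c) = Amap R g X (cXv R g v X c) :=
  aux_map_contract R (Matrix.toLin' X).dualMap (Module.Dual.eval R (Fin (g + 1) → R) v) c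

/- Definition 3.3 / the first assertion of Proposition 3.4: with `e = 1`, `f = g + 1`, data
`(𝔟, v, X)`, the modules `P_i = ⋀^i G* ⊕ ⋀^i F* ⊕ ⋀^{i-1} G*` with differential
`[[X(v), B_i, (-1)^{i+1} 𝔟], [0, -v, A_{i-1}], [0, 0, X(v)]]` form a complex:
`d_i ∘ d_{i+1} = 0` for all `i`.  (All the maps involved are restrictions of maps defined on
the whole exterior algebras, and the differential is stated at that level.) -/
theorem stmt_10 (R : Type*) [CommRing R] (g : ℕ) (𝔟 : R) (v : Fin (g + 1) → R)
    (X : Matrix (Fin g) (Fin (g + 1)) R) (i : ℕ) :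
    (dP R g 𝔟 v X i) ∘ₗ (dP R g 𝔟 v X (i + 1)) = 0 := by
  refine LinearMap.ext fun p => ?_
  obtain ⟨a, b, c⟩ := p
  have hX : ∀ y, cXv R g v X (cXv R g v X y) = 0 := fun y =>
    CliffordAlgebra.contractLeft_contractLeft _ y
  have hv : ∀ y, cv R g v (cv R g v y) = 0 := fun y =>
    CliffordAlgebra.contractLeft_contractLeft _ y
  refine Prod.ext ?_ (Prod.ext ?_ ?_)
  · change cXv R g v X (cXv R g v X a + Bmap R g X b + ((-1 : R) ^ (i + 1 + 1) * 𝔟) • c) +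
      Bmap R g X (-(cv R g v b) + Amap R g X c) +
      ((-1 : R) ^ (i + 1) * 𝔟) • cXv R g v X c = 0
    rw [map_add, map_add, map_add, map_neg, map_smul, hX, aux_BA, aux_XB, pow_succ _ (i + 1)]
    module
  · change -(cv R g v (-(cv R g v b) + Amap R g X c)) + Amap R g X (cXv R g v X c) = 0
    rw [map_add, map_neg, hv, aux_vA]
    module
  · exact hX c


end
end

section
/- With the complexes P and P' of Definition 3.3 built from data (𝔟, v, X) with e = 1, f = g+1 (P' obtained from P by truncating and modifying the last two terms: P'_1 = ⋀^1 G* ⊕ ⋀^1 F*, P'_0 = R, d'_1 = [X(v), B_1 + 𝔟 v]), the maps q_i = id for i ≥ 2, q_1 = projection forgetting the ⋀^0 G* summand, and q_0 = [1, -𝔟] : ⋀^0 G* ⊕ ⋀^0 F* → R form a map of complexes q : P → P'. -/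
set_option synthInstance.maxHeartbeats 1000000
set_option maxHeartbeats 1000000

noncomputable section

open ExteriorAlgebra

variable (R : Type*) [CommRing R] (M : Type*) [AddCommGroup M] [Module R M]

variable (g : ℕ) (𝔟 : R) (v : Fin (g + 1) → R) (X : Matrix (Fin g) (Fin (g + 1)) R)

/-- The degree-zero part of an element of `⋀ G*`. -/
def scG (g : ℕ) : LG R g →ₗ[R] R := (ExteriorAlgebra.algebraMapInv).toLinearMap

/-- The degree-zero part of an element of `⋀ F*`. -/
def scF (g : ℕ) : LF R g →ₗ[R] R := (ExteriorAlgebra.algebraMapInv).toLinearMap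

/-- The differential `d'_2 = [[X(v), B_2, -𝔟], [0, -v, A_1]]` of the complex `P'`. -/
def dP'2 : PM R g →ₗ[R] LG R g × LF R g :=
  ((cXv R g v X) ∘ₗ pr1 R g + (Bmap R g X) ∘ₗ pr2 R g + ((-𝔟) • pr3 R g)).prod
    ((-(cv R g v)) ∘ₗ pr2 R g + (Amap R g X) ∘ₗ pr3 R g)

/-- The differential `d'_1 = [X(v), B_1 + 𝔟 v]` of the complex `P'`. -/
def dP'1 : LG R g × LF R g →ₗ[R] R :=
  (scG R g) ∘ₗ (cXv R g v X) ∘ₗ (LinearMap.fst R (LG R g) (LF R g)) +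
    (scG R g) ∘ₗ (Bmap R g X) ∘ₗ (LinearMap.snd R (LG R g) (LF R g)) +
    𝔟 • ((scF R g) ∘ₗ (cv R g v) ∘ₗ (LinearMap.snd R (LG R g) (LF R g)))

/-- `q_1 : P_1 → P'_1` forgets the `⋀^0 G*` summand. -/
def q1 (g : ℕ) : PM R g →ₗ[R] LG R g × LF R g := (pr1 R g).prod (pr2 R g)

/-- `q_0 = [1, -𝔟] : P_0 → P'_0 = R`. -/
def q0 (g : ℕ) (𝔟 : R) : PM R g →ₗ[R] R :=
  (scG R g) ∘ₗ pr1 R g - 𝔟 • ((scF R g) ∘ₗ pr2 R g)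

theorem scF_Amap_aux (R : Type*) [CommRing R] (g : ℕ) (X : Matrix (Fin g) (Fin (g + 1)) R)
    (z : LG R g) : scF R g (Amap R g X z) = scG R g z := by
  have h : (ExteriorAlgebra.algebraMapInv).comp
      (ExteriorAlgebra.map (Matrix.toLin' X).dualMap) =
      (ExteriorAlgebra.algebraMapInv : LG R g →ₐ[R] R) := by
    apply ExteriorAlgebra.hom_ext
    ext m
    simp [ExteriorAlgebra.algebraMapInv]
  exact DFunLike.congr_fun h z

/- Definition 3.3, last assertion: the maps `q_i` (`q_i = id` for `i ≥ 2`, `q_1` and `q_0` as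
above) form a map of complexes `q : P → P'`; the only two nontrivial commutativity conditions
are recorded. -/
theorem stmt_11 (R : Type*) [CommRing R] (g : ℕ) (𝔟 : R) (v : Fin (g + 1) → R)
    (X : Matrix (Fin g) (Fin (g + 1)) R) :
    (q1 R g) ∘ₗ (dP R g 𝔟 v X 2) = dP'2 R g 𝔟 v X ∧
    (q0 R g 𝔟) ∘ₗ (dP R g 𝔟 v X 1) = (dP'1 R g 𝔟 v X) ∘ₗ (q1 R g) := by
  constructor
  · apply LinearMap.ext
    intro p
    have h3 : ((-1 : R) ^ (2 + 1) * 𝔟) = -𝔟 := by ring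
    simp only [dP, dP'2, h3]
    rfl
  · apply LinearMap.ext
    rintro ⟨x, y, z⟩
    have h2 : ((-1 : R) ^ (1 + 1) * 𝔟) = 𝔟 := by ring
    have hA := scF_Amap_aux R g X z
    simp only [dP, dP'1, q0, q1, pr1, pr2, pr3, h2, LinearMap.comp_apply, LinearMap.sub_apply,
      LinearMap.add_apply, LinearMap.smul_apply, LinearMap.neg_apply, LinearMap.prod_apply,
      Function.prod_apply, LinearMap.fst_apply, LinearMap.snd_apply, map_add, map_neg, map_smul,
      smul_eq_mul, hA]
    ring

end
end

section
/- Let 𝔟, the entries v_{j1} of a column vector v of length f = g+1, and the entries x_{ij} of a g×f matrix X be indeterminates over a commutative noetherian ring R_0, and R the resulting polynomial ring. Then the complex P with P_i = ⋀^i G* ⊕ ⋀^i F* ⊕ ⋀^{i-1} G* and differential [[X(v), B_i, (-1)^{i+1}𝔟],[0,-v,A_{i-1}],[0,0,X(v)]] is acyclic, i.e., H_i(P) = 0 for all i ≥ 1. -/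
set_option synthInstance.maxHeartbeats 1000000
set_option maxHeartbeats 1000000

noncomputable section

open ExteriorAlgebra

variable (R : Type*) [CommRing R] (M : Type*) [AddCommGroup M] [Module R M]

variable (g : ℕ) (𝔟 : R) (v : Fin (g + 1) → R) (X : Matrix (Fin g) (Fin (g + 1)) R)

/-- The generic base ring: the polynomial ring over `R₀` whose variables are `𝔟`, the entries
`v_j` of the column `v` (`j : Fin (g+1)`) and the entries `x_{ij}` of `X`. -/
abbrev Rgen (R₀ : Type*) [CommRing R₀] (g : ℕ) :=
  MvPolynomial (Unit ⊕ Fin (g + 1) ⊕ (Fin g × Fin (g + 1))) R₀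

def bgen (R₀ : Type*) [CommRing R₀] (g : ℕ) : Rgen R₀ g := MvPolynomial.X (Sum.inl ())

def vgen (R₀ : Type*) [CommRing R₀] (g : ℕ) : Fin (g + 1) → Rgen R₀ g := fun j =>
  MvPolynomial.X (Sum.inr (Sum.inl j))

def Xgen (R₀ : Type*) [CommRing R₀] (g : ℕ) : Matrix (Fin g) (Fin (g + 1)) (Rgen R₀ g) :=
  fun i j => MvPolynomial.X (Sum.inr (Sum.inr (i, j)))

section helpers_ext

/-- contraction -/
def ctr {R : Type*} [CommRing R] {V : Type*} [AddCommGroup V] [Module R V] (d : Module.Dual R V) :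
    ExteriorAlgebra R V →ₗ[R] ExteriorAlgebra R V :=
  CliffordAlgebra.contractLeft (Q := (0 : QuadraticForm R V)) d

theorem ctr_ι_mul {R : Type*} [CommRing R] {V : Type*} [AddCommGroup V] [Module R V]
    (d : Module.Dual R V) (a : V) (x : ExteriorAlgebra R V) :
    ctr d (ι R a * x) = d a • x - ι R a * ctr d x :=
  CliffordAlgebra.contractLeft_ι_mul ..

theorem ctr_ι {R : Type*} [CommRing R] {V : Type*} [AddCommGroup V] [Module R V]
    (d : Module.Dual R V) (a : V) :
    ctr d (ι R a) = algebraMap R _ (d a) :=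
  CliffordAlgebra.contractLeft_ι ..

theorem ctr_algebraMap {R : Type*} [CommRing R] {V : Type*} [AddCommGroup V] [Module R V]
    (d : Module.Dual R V) (a : R) :
    ctr d (algebraMap R (ExteriorAlgebra R V) a) = 0 :=
  CliffordAlgebra.contractLeft_algebraMap ..

theorem ctr_ctr {R : Type*} [CommRing R] {V : Type*} [AddCommGroup V] [Module R V]
    (d : Module.Dual R V) (x : ExteriorAlgebra R V) : ctr d (ctr d x) = 0 :=
  CliffordAlgebra.contractLeft_contractLeft ..

theorem ctr_comm {R : Type*} [CommRing R] {V : Type*} [AddCommGroup V] [Module R V]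
    (d d' : Module.Dual R V) (x : ExteriorAlgebra R V) : ctr d (ctr d' x) = - ctr d' (ctr d x) :=
  CliffordAlgebra.contractLeft_comm ..

theorem ext_ind {R : Type*} [CommRing R] {V : Type*} [AddCommGroup V] [Module R V]
    {P : ExteriorAlgebra R V → Prop} (h0 : ∀ r, P (algebraMap R _ r))
    (ha : ∀ x y, P x → P y → P (x + y)) (hm : ∀ x m, P x → P (ι R m * x)) (x) : P x :=
  CliffordAlgebra.left_induction (Q := (0 : QuadraticForm R V)) (P := P) h0 ha hm x

theorem mem_pow_zero {R : Type*} [CommRing R] {V : Type*} [AddCommGroup V] [Module R V]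
    {x : ExteriorAlgebra R V} (hx : x ∈ ⋀[R]^0 V) : ∃ r, x = algebraMap R _ r := by
  have : x ∈ (1 : Submodule R (ExteriorAlgebra R V)) := by simpa using hx
  obtain ⟨r, hr⟩ := Submodule.mem_one.1 this
  exact ⟨r, hr.symm⟩

theorem algebraMap_mem_pow {R : Type*} [CommRing R] {V : Type*} [AddCommGroup V] [Module R V]
    (r : R) : algebraMap R (ExteriorAlgebra R V) r ∈ ⋀[R]^0 V := by
  have : algebraMap R (ExteriorAlgebra R V) r ∈ (1 : Submodule R (ExteriorAlgebra R V)) :=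
    Submodule.mem_one.2 ⟨r, rfl⟩
  simp

theorem mem_pow_one {R : Type*} [CommRing R] {V : Type*} [AddCommGroup V] [Module R V]
    {x : ExteriorAlgebra R V} (hx : x ∈ ⋀[R]^1 V) : ∃ m, x = ι R m := by
  have : x ∈ LinearMap.range (ι R : V →ₗ[R] _) := by simpa [exteriorPower] using hx
  obtain ⟨r, hr⟩ := this
  exact ⟨r, hr.symm⟩

theorem ι_mem_pow {R : Type*} [CommRing R] {V : Type*} [AddCommGroup V] [Module R V]
    (m : V) : ι R m ∈ ⋀[R]^1 V := by
  have : ι R m ∈ LinearMap.range (ι R : V →ₗ[R] _) := ⟨m, rfl⟩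
  simp [exteriorPower]

theorem ι_mul_mem_pow {R : Type*} [CommRing R] {V : Type*} [AddCommGroup V] [Module R V]
    (m : V) {n : ℕ} {x : ExteriorAlgebra R V} (hx : x ∈ ⋀[R]^n V) : ι R m * x ∈ ⋀[R]^(n+1) V := by
  rw [exteriorPower, pow_succ']
  exact Submodule.mul_mem_mul ⟨m, rfl⟩ hx

theorem pow_succ_ind {R : Type*} [CommRing R] {V : Type*} [AddCommGroup V] [Module R V]
    {n : ℕ} {P : ExteriorAlgebra R V → Prop}
    (hm : ∀ m, ∀ x ∈ ⋀[R]^n V, P (ι R m * x)) (ha : ∀ x y, P x → P y → P (x + y))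
    {x : ExteriorAlgebra R V} (hx : x ∈ ⋀[R]^(n+1) V) : P x := by
  rw [exteriorPower, pow_succ'] at hx
  refine Submodule.mul_induction_on hx ?_ ha
  rintro _ ⟨m, rfl⟩ y hy
  exact hm m y hy

theorem ctr_mem {R : Type*} [CommRing R] {V : Type*} [AddCommGroup V] [Module R V]
    (d : Module.Dual R V) {n : ℕ} : ∀ {x : ExteriorAlgebra R V}, x ∈ ⋀[R]^(n+1) V →
      ctr d x ∈ ⋀[R]^n V := by
  induction n with
  | zero =>
    intro x hx
    obtain ⟨m, rfl⟩ := mem_pow_one hx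
    rw [ctr_ι]; exact algebraMap_mem_pow _
  | succ n ih =>
    intro x hx
    refine pow_succ_ind (P := fun x => ctr d x ∈ ⋀[R]^(n+1) V) ?_ ?_ hx
    · intro m y hy
      rw [ctr_ι_mul]
      exact Submodule.sub_mem _ (Submodule.smul_mem _ _ hy) (ι_mul_mem_pow m (ih hy))
    · intro x y hx hy
      rw [map_add]; exact Submodule.add_mem _ hx hy

theorem map_mem_pow {R : Type*} [CommRing R] {V W : Type*} [AddCommGroup V] [Module R V]
    [AddCommGroup W] [Module R W] (f : V →ₗ[R] W) {n : ℕ} :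
    ∀ {x : ExteriorAlgebra R V}, x ∈ ⋀[R]^n V → ExteriorAlgebra.map f x ∈ ⋀[R]^n W := by
  induction n with
  | zero =>
    intro x hx
    obtain ⟨m, rfl⟩ := mem_pow_zero hx
    rw [AlgHom.commutes]; exact algebraMap_mem_pow _
  | succ n ih =>
    intro x hx
    refine pow_succ_ind (P := fun x => ExteriorAlgebra.map f x ∈ ⋀[R]^(n+1) W) ?_ ?_ hx
    · intro m y hy
      rw [map_mul, map_apply_ι]
      exact ι_mul_mem_pow _ (ih hy)
    · intro x y hx hy
      rw [map_add]; exact Submodule.add_mem _ hx hy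

theorem ctr_map {R : Type*} [CommRing R] {V W : Type*} [AddCommGroup V] [Module R V]
    [AddCommGroup W] [Module R W] (f : V →ₗ[R] W) (d : Module.Dual R W) (x : ExteriorAlgebra R V) :
    ctr d (ExteriorAlgebra.map f x) = ExteriorAlgebra.map f (ctr (d ∘ₗ f) x) := by
  induction x using ext_ind with
  | h0 r => rw [AlgHom.commutes, ctr_algebraMap, ctr_algebraMap, map_zero]
  | ha x y hx hy => simp only [map_add, hx, hy]
  | hm x m hx =>
    rw [map_mul, map_apply_ι, ctr_ι_mul, ctr_ι_mul, hx, map_sub, map_smul, map_mul, map_apply_ι]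
    rfl

theorem map_proj {R : Type*} [CommRing R] {V : Type*} [AddCommGroup V] [Module R V]
    (d : Module.Dual R V) (e : V) (x : ExteriorAlgebra R V) :
    ExteriorAlgebra.map (LinearMap.id - d.smulRight e) x = x - ι R e * ctr d x := by
  induction x using ext_ind with
  | h0 r => rw [AlgHom.commutes, ctr_algebraMap, mul_zero, sub_zero]
  | ha x y hx hy => simp only [map_add, hx, hy, mul_add]; abel
  | hm x m hx =>
    have h1 : ι R e * ι R e = 0 := ι_sq_zero e
    have h2 : ι R m * ι R e = - (ι R e * ι R m) := eq_neg_of_add_eq_zero_left (ι_add_mul_swap m e)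
    rw [map_mul, map_apply_ι, ctr_ι_mul, hx]
    simp only [LinearMap.sub_apply, LinearMap.id_apply, LinearMap.smulRight_apply, map_sub,
      map_smul, sub_mul, mul_sub, smul_mul_assoc, mul_smul_comm, ← mul_assoc, h1, h2, zero_mul,
      smul_zero, neg_mul]
    abel

theorem eq_zero_of_ctr {R : Type*} [CommRing R] {V : Type*} [AddCommGroup V] [Module R V]
    {n : ℕ} (e : Module.Basis (Fin n) R V) {i : ℕ} {z : ExteriorAlgebra R V}
    (hz : z ∈ ⋀[R]^(i+1) V) (h : ∀ j, ctr (e.coord j) z = 0) : z = 0 := by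
  have key : ∀ s : Finset (Fin n), ExteriorAlgebra.map
      (LinearMap.id - ∑ j ∈ s, (e.coord j).smulRight (e j)) z = z := by
    intro s
    induction s using Finset.induction_on with
    | empty => simp
    | insert a s ha ih =>
      have : (LinearMap.id - ∑ j ∈ insert a s, (e.coord j).smulRight (e j) : V →ₗ[R] V) =
          (LinearMap.id - (e.coord a).smulRight (e a)) ∘ₗ
          (LinearMap.id - ∑ j ∈ s, (e.coord j).smulRight (e j)) := by
        rw [Finset.sum_insert ha, LinearMap.sub_comp, LinearMap.id_comp, LinearMap.comp_sub,
          LinearMap.comp_id]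
        have h0 : ((e.coord a).smulRight (e a)) ∘ₗ (∑ j ∈ s, (e.coord j).smulRight (e j)) = 0 := by
          ext x
          simp only [LinearMap.comp_apply, LinearMap.sum_apply, map_sum, LinearMap.zero_apply]
          refine Finset.sum_eq_zero fun j hj => ?_
          have : j ≠ a := fun hh => ha (hh ▸ hj)
          simp [Finsupp.single_apply, this]
        rw [h0, sub_zero]; abel
      rw [this, ← map_comp_map, AlgHom.comp_apply, ih, map_proj, h, mul_zero, sub_zero]
  have h1 := key Finset.univ
  have h2 : (LinearMap.id - ∑ j, (e.coord j).smulRight (e j) : V →ₗ[R] V) = 0 := by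
    ext x
    simp [e.sum_repr]
  rw [h2] at h1
  rw [← h1]
  refine pow_succ_ind (P := fun x => ExteriorAlgebra.map (0 : V →ₗ[R] V) x = 0) ?_ ?_ hz
  · intro m x _
    simp
  · intro x y hx hy
    rw [map_add, hx, hy, add_zero]

theorem koszul_aux {R : Type*} [CommRing R] {V : Type*} [AddCommGroup V] [Module R V]
    {n : ℕ} (e : Module.Basis (Fin n) R V) (w : Module.Dual R V)
    (hw : ∀ k : Fin n, ∀ a, w (e k) * a ∈ Ideal.span {x | ∃ j < k, x = w (e j)} →
      a ∈ Ideal.span {x | ∃ j < k, x = w (e j)}) (k : ℕ) (hk : k ≤ n) :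
    ∀ (i : ℕ) (z : ExteriorAlgebra R V), z ∈ ⋀[R]^(i+1) V →
      (∀ j : Fin n, k ≤ j → ctr (e.coord j) z = 0) → ctr w z = 0 →
      ∃ y ∈ ⋀[R]^(i+2) V, (∀ j : Fin n, k ≤ j → ctr (e.coord j) y = 0) ∧ ctr w y = z := by
  induction k with
  | zero =>
    intro i z hz h _
    refine ⟨0, Submodule.zero_mem _, fun j _ => map_zero _, ?_⟩
    rw [eq_zero_of_ctr e hz (fun j => h j (Nat.zero_le _)), map_zero]
  | succ k ih =>
    intro i z hz h hD
    have ih := ih (by omega)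
    let K : Fin n := ⟨k, hk⟩
    obtain ⟨b, hb⟩ : ∃ b, b = ctr (e.coord K) z := ⟨_, rfl⟩
    have hbm : b ∈ ⋀[R]^i V := hb ▸ ctr_mem _ hz
    obtain ⟨a, ha⟩ : ∃ a, a = z - ι R (e K) * b := ⟨_, rfl⟩
    have ham : a ∈ ⋀[R]^(i+1) V := ha ▸ Submodule.sub_mem _ hz (ι_mul_mem_pow _ hbm)
    have hbk : ∀ j : Fin n, k ≤ j → ctr (e.coord j) b = 0 := by
      intro j hj
      rcases Nat.eq_or_lt_of_le hj with hj | hj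
      · have : j = K := Fin.ext hj.symm
        rw [this, hb, ctr_ctr]
      · rw [hb, ctr_comm, h j hj, map_zero, neg_zero]
    have hek : ∀ j : Fin n, k ≤ j → ∀ x, (∀ j : Fin n, k ≤ j → ctr (e.coord j) x = 0) →
        k < j → ctr (e.coord j) (ι R (e K) * x) = 0 := by
      intro j hj x hx hlt
      rw [ctr_ι_mul, hx j hj]
      have : K ≠ j := fun hh => by rw [← hh] at hlt; exact lt_irrefl _ hlt
      simp [Finsupp.single_apply, this]
    have hak : ∀ j : Fin n, k ≤ j → ctr (e.coord j) a = 0 := by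
      intro j hj
      rcases Nat.eq_or_lt_of_le hj with hj' | hj'
      · have : j = K := Fin.ext hj'.symm
        subst this
        rw [ha, map_sub, ctr_ι_mul, hbk _ hj, ← hb]
        simp
      · rw [ha, map_sub, h j hj', hek j hj b hbk hj', sub_zero]
    have hzz : z = a + ι R (e K) * b := by rw [ha]; abel
    have hDb : ctr w b = 0 := by
      rw [hb, ctr_comm, hD, map_zero, neg_zero]
    have hDa : ctr w a = - (w (e K) • b) := by
      rw [ha, map_sub, ctr_ι_mul, hD, hDb]; simp
    -- find c
    have hc : ∃ c ∈ ⋀[R]^(i+1) V, (∀ j : Fin n, k ≤ j → ctr (e.coord j) c = 0) ∧ ctr w c = b := by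
      cases i with
      | succ i => exact ih i b hbm hbk hDb
      | zero =>
        obtain ⟨β, rfl⟩ := mem_pow_zero hbm
        obtain ⟨α, rfl⟩ := mem_pow_one ham
        have hα : ∀ j : Fin n, k ≤ j → e.coord j α = 0 := by
          intro j hj
          have := hak j hj
          rwa [ctr_ι, algebraMap_eq_zero_iff] at this
        have hDa' : w (e K) * β = - w α := by
          rw [ctr_ι, Algebra.smul_def, ← map_mul, ← map_neg, algebraMap_inj] at hDa
          rw [hDa, neg_neg]
        have hβ : β ∈ Ideal.span {x | ∃ j < K, x = w (e j)} := by
          apply hw K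
          rw [hDa', ← e.sum_repr α, map_sum]
          refine Submodule.neg_mem _ (Submodule.sum_mem _ fun j _ => ?_)
          rw [map_smul, smul_eq_mul]
          by_cases hj : k ≤ j
          · have := hα j hj
            rw [Module.Basis.coord_apply] at this
            rw [this, zero_mul]; exact Submodule.zero_mem _
          · exact Ideal.mul_mem_left _ _ (Ideal.subset_span ⟨j, by
              rw [Fin.lt_def]; exact not_le.1 hj, rfl⟩)
        clear hb hbk hDb hbm ha hzz hDa hDa'
        refine Submodule.span_induction (p := fun β _ => ∃ c ∈ ⋀[R]^(0+1) V,
          (∀ j : Fin n, k ≤ j → ctr (e.coord j) c = 0) ∧ ctr w c = algebraMap R _ β)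
          ?_ ?_ ?_ ?_ hβ
        · rintro _ ⟨j, hj, rfl⟩
          refine ⟨ι R (e j), ι_mem_pow _, fun l hl => ?_, ctr_ι _ _⟩
          have : j ≠ l := fun hh => by
            rw [← hh] at hl; rw [Fin.lt_def] at hj; exact absurd hl (not_le.2 hj)
          simp [ctr_ι, Finsupp.single_apply, this]
        · exact ⟨0, Submodule.zero_mem _, fun _ _ => map_zero _, by simp⟩
        · rintro x y _ _ ⟨c, h1, h2, h3⟩ ⟨c', h1', h2', h3'⟩
          exact ⟨c + c', Submodule.add_mem _ h1 h1', fun j hj => by simp [h2 j hj, h2' j hj],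
            by simp [h3, h3']⟩
        · rintro r x _ ⟨c, h1, h2, h3⟩
          exact ⟨r • c, Submodule.smul_mem _ _ h1, fun j hj => by simp [h2 j hj],
            by rw [map_smul, h3, smul_eq_mul, map_mul, Algebra.smul_def]⟩
    obtain ⟨c, hcm, hck, hDc⟩ := hc
    obtain ⟨c', hcm', hck', hDc'⟩ := ih i (a + w (e K) • c)
      (Submodule.add_mem _ ham (Submodule.smul_mem _ _ hcm))
      (fun j hj => by rw [map_add, map_smul, hak j hj, hck j hj]; simp)
      (by rw [map_add, map_smul, hDa, hDc]; simp)
    refine ⟨c' - ι R (e K) * c, Submodule.sub_mem _ hcm' (ι_mul_mem_pow _ hcm), ?_, ?_⟩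
    · intro j hj
      rw [map_sub, hck' j (by omega), hek j (by omega) c hck hj, sub_zero]
    · rw [map_sub, ctr_ι_mul, hDc', hDc, hzz]; abel

theorem koszul {R : Type*} [CommRing R] {V : Type*} [AddCommGroup V] [Module R V]
    {n : ℕ} (e : Module.Basis (Fin n) R V) (w : Module.Dual R V)
    (hw : ∀ k : Fin n, ∀ a, w (e k) * a ∈ Ideal.span {x | ∃ j < k, x = w (e j)} →
      a ∈ Ideal.span {x | ∃ j < k, x = w (e j)})
    (i : ℕ) (z : ExteriorAlgebra R V) (hz : z ∈ ⋀[R]^(i+1) V) (h : ctr w z = 0) :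
    ∃ y ∈ ⋀[R]^(i+2) V, ctr w y = z := by
  obtain ⟨y, h1, _, h2⟩ := koszul_aux e w hw n le_rfl i z hz
    (fun j hj => absurd j.2 (not_lt.2 hj)) h
  exact ⟨y, h1, h2⟩

/-- integer-graded pieces -/
def zpc (R : Type*) [CommRing R] (V : Type*) [AddCommGroup V] [Module R V] (k : ℤ) :
    Submodule R (ExteriorAlgebra R V) := if 0 ≤ k then ⋀[R]^(k.toNat) V else ⊥

theorem zpc_nat (R : Type*) [CommRing R] (V : Type*) [AddCommGroup V] [Module R V] (k : ℕ) :
    zpc R V k = ⋀[R]^k V := by simp [zpc]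

theorem zpc_neg (R : Type*) [CommRing R] (V : Type*) [AddCommGroup V] [Module R V] (k : ℤ)
    (hk : k < 0) : zpc R V k = ⊥ := by simp [zpc, not_le.2 hk]

theorem ctr_zpc {R : Type*} [CommRing R] {V : Type*} [AddCommGroup V] [Module R V]
    (d : Module.Dual R V) {k : ℤ} {x : ExteriorAlgebra R V} (hx : x ∈ zpc R V k) :
    ctr d x ∈ zpc R V (k - 1) := by
  rcases lt_or_ge k 0 with hk | hk
  · rw [zpc_neg _ _ _ hk, Submodule.mem_bot] at hx
    rw [hx, map_zero]; exact Submodule.zero_mem _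
  · obtain ⟨n, rfl⟩ := Int.eq_ofNat_of_zero_le hk
    rw [zpc_nat] at hx
    cases n with
    | zero =>
      obtain ⟨r, rfl⟩ := mem_pow_zero hx
      rw [ctr_algebraMap]; exact Submodule.zero_mem _
    | succ n =>
      have : ((n + 1 : ℕ) : ℤ) - 1 = (n : ℕ) := by push_cast; ring
      rw [this, zpc_nat]; exact ctr_mem d hx

theorem interiorL_ι_mul {R : Type*} [CommRing R] {V : Type*} [AddCommGroup V] [Module R V]
    (d : Module.Dual R V) (x : ExteriorAlgebra R (Module.Dual R V)) (y : ExteriorAlgebra R V) :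
    interiorL R V (ι R d * x) y = ctr d (interiorL R V x y) := by
  rw [map_mul, interiorL, lift_ι_apply]; rfl

theorem interiorR_ι_mul {R : Type*} [CommRing R] {V : Type*} [AddCommGroup V] [Module R V]
    (d : V) (x : ExteriorAlgebra R V) (y : ExteriorAlgebra R (Module.Dual R V)) :
    interiorR R V (ι R d * x) y = ctr (Module.Dual.eval R V d) (interiorR R V x y) := by
  rw [map_mul, interiorR, lift_ι_apply]; rfl

theorem interiorL_alg {R : Type*} [CommRing R] {V : Type*} [AddCommGroup V] [Module R V]
    (r : R) (y : ExteriorAlgebra R V) :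
    interiorL R V (algebraMap R _ r) y = r • y := by
  rw [AlgHom.commutes]; rfl

theorem interiorR_alg {R : Type*} [CommRing R] {V : Type*} [AddCommGroup V] [Module R V]
    (r : R) (y : ExteriorAlgebra R (Module.Dual R V)) :
    interiorR R V (algebraMap R _ r) y = r • y := by
  rw [AlgHom.commutes]; rfl

theorem interiorL_zpc {R : Type*} [CommRing R] {V : Type*} [AddCommGroup V] [Module R V]
    {m : ℤ} {y : ExteriorAlgebra R V} (hy : y ∈ zpc R V m) {n : ℕ} :
    ∀ {x : ExteriorAlgebra R (Module.Dual R V)}, x ∈ ⋀[R]^n (Module.Dual R V) →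
      interiorL R V x y ∈ zpc R V (m - n) := by
  induction n with
  | zero =>
    intro x hx
    obtain ⟨r, rfl⟩ := mem_pow_zero hx
    rw [interiorL_alg]; simpa using Submodule.smul_mem _ _ hy
  | succ n ih =>
    intro x hx
    refine pow_succ_ind (P := fun x => interiorL R V x y ∈ zpc R V (m - (n+1 : ℕ))) ?_ ?_ hx
    · intro d x hx
      rw [interiorL_ι_mul]
      have := ctr_zpc d (ih hx)
      convert this using 2
      push_cast; ring
    · intro x x' h h'
      rw [map_add]; exact Submodule.add_mem _ h h'

theorem interiorR_zpc {R : Type*} [CommRing R] {V : Type*} [AddCommGroup V] [Module R V]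
    {m : ℤ} {y : ExteriorAlgebra R (Module.Dual R V)} (hy : y ∈ zpc R (Module.Dual R V) m) {n : ℕ} :
    ∀ {x : ExteriorAlgebra R V}, x ∈ ⋀[R]^n V →
      interiorR R V x y ∈ zpc R (Module.Dual R V) (m - n) := by
  induction n with
  | zero =>
    intro x hx
    obtain ⟨r, rfl⟩ := mem_pow_zero hx
    rw [interiorR_alg]; simpa using Submodule.smul_mem _ _ hy
  | succ n ih =>
    intro x hx
    refine pow_succ_ind
      (P := fun x => interiorR R V x y ∈ zpc R (Module.Dual R V) (m - (n+1 : ℕ))) ?_ ?_ hx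
    · intro d x hx
      rw [interiorR_ι_mul]
      have := ctr_zpc (Module.Dual.eval R V d) (ih hx)
      convert this using 2
      push_cast; ring
    · intro x x' h h'
      rw [map_add]; exact Submodule.add_mem _ h h'

theorem interiorL_map {R : Type*} [CommRing R] {V W : Type*} [AddCommGroup V] [Module R V]
    [AddCommGroup W] [Module R W] (f : V →ₗ[R] W) (a : ExteriorAlgebra R (Module.Dual R W))
    (y : ExteriorAlgebra R V) :
    ExteriorAlgebra.map f (interiorL R V (ExteriorAlgebra.map f.dualMap a) y) =
      interiorL R W a (ExteriorAlgebra.map f y) := by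
  induction a using ext_ind with
  | h0 r => rw [AlgHom.commutes, interiorL_alg, interiorL_alg, map_smul]
  | ha x y hx hy => simp only [map_add, LinearMap.add_apply, hx, hy]
  | hm x m hx =>
    rw [map_mul, map_apply_ι, interiorL_ι_mul, interiorL_ι_mul, ← hx, ctr_map]; rfl

theorem wedge_interiorL {R : Type*} [CommRing R] {V : Type*} [AddCommGroup V] [Module R V]
    (u : V) (y : ExteriorAlgebra R V) (hy : ι R u * y = 0)
    (a : ExteriorAlgebra R (Module.Dual R V)) :
    interiorL R V (ctr (Module.Dual.eval R V u) a) y = ι R u * interiorL R V a y := by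
  induction a using ext_ind with
  | h0 r => rw [ctr_algebraMap, interiorL_alg, mul_smul_comm, hy]; simp
  | ha x y hx hy => simp only [map_add, LinearMap.add_apply, hx, hy, mul_add]
  | hm x m hx =>
    have h1 := ctr_ι_mul m u (interiorL R V x y)
    rw [← hx] at h1
    rw [ctr_ι_mul, map_sub, LinearMap.sub_apply, interiorL_ι_mul, interiorL_ι_mul, h1, map_smul]
    simp

theorem omegaF_mem (R : Type*) [CommRing R] (g : ℕ) :
    omegaF R g ∈ ⋀[R]^(g+1) (Fin (g+1) → R) := (ιMulti_range R (g+1)) ⟨_, rfl⟩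

theorem omegaGd_mem (R : Type*) [CommRing R] (g : ℕ) :
    omegaGd R g ∈ ⋀[R]^g (Module.Dual R (Fin g → R)) := (ιMulti_range R g) ⟨_, rfl⟩

theorem wedge_omegaF (R : Type*) [CommRing R] (g : ℕ) (u : Fin (g+1) → R) :
    ι R u * omegaF R g = 0 := by
  rw [← (Pi.basisFun R (Fin (g+1))).sum_repr u, map_sum, Finset.sum_mul]
  refine Finset.sum_eq_zero fun j _ => ?_
  rw [map_smul, smul_mul_assoc, omegaF, ιMulti_apply, Pi.basisFun_apply]
  have := ι_mul_prod_list (R := R) (fun j : Fin (g+1) => (Pi.single j 1 : Fin (g+1) → R)) j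
  rw [this, smul_zero]

theorem map_omegaF (R : Type*) [CommRing R] (g : ℕ) (X : Matrix (Fin g) (Fin (g+1)) R) :
    ExteriorAlgebra.map (Matrix.toLin' X) (omegaF R g) = 0 := by
  have : (ιMulti R (g+1) : (Fin g → R) [⋀^Fin (g+1)]→ₗ[R] _) = 0 := by
    refine Module.Basis.ext_alternating (Pi.basisFun R (Fin g)) fun w hw => ?_
    have := Fintype.card_le_of_injective _ hw
    simp at this
  rw [omegaF, map_apply_ιMulti, this]; rfl

theorem Bmap_apply (R : Type*) [CommRing R] (g : ℕ) (X : Matrix (Fin g) (Fin (g+1)) R) (a : LF R g) :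
    Bmap R g X a = interiorR R (Fin g → R) (ExteriorAlgebra.map (Matrix.toLin' X)
      (interiorL R (Fin (g+1) → R) a (omegaF R g))) (omegaGd R g) := rfl

theorem B_A (R : Type*) [CommRing R] (g : ℕ) (X : Matrix (Fin g) (Fin (g+1)) R) (a : LG R g) :
    Bmap R g X (Amap R g X a) = 0 := by
  rw [Bmap_apply, Amap, AlgHom.toLinearMap_apply, interiorL_map, map_omegaF]; simp

theorem B_v (R : Type*) [CommRing R] (g : ℕ) (v : Fin (g+1) → R) (X : Matrix (Fin g) (Fin (g+1)) R)
    (a : LF R g) : Bmap R g X (cv R g v a) = cXv R g v X (Bmap R g X a) := by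
  have := wedge_interiorL v _ (wedge_omegaF R g v) a
  rw [Bmap_apply, Bmap_apply]
  change interiorR R _ (ExteriorAlgebra.map _ (interiorL R _ (ctr _ a) _)) _ = ctr _ _
  rw [this, map_mul, map_apply_ι, interiorR_ι_mul]

theorem v_A (R : Type*) [CommRing R] (g : ℕ) (v : Fin (g+1) → R) (X : Matrix (Fin g) (Fin (g+1)) R)
    (a : LG R g) : cv R g v (Amap R g X a) = Amap R g X (cXv R g v X a) :=
  ctr_map (Matrix.toLin' X).dualMap (Module.Dual.eval R _ v) a

theorem B_mem (R : Type*) [CommRing R] (g : ℕ) (X : Matrix (Fin g) (Fin (g+1)) R) (i : ℕ)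
    (a : LF R g) (ha : a ∈ ⋀[R]^(i+1) (Module.Dual R (Fin (g+1) → R))) :
    Bmap R g X a ∈ ⋀[R]^i (Module.Dual R (Fin g → R)) := by
  rw [Bmap_apply]
  have h1 := omegaF_mem R g
  rw [← zpc_nat] at h1
  have h2 := interiorL_zpc h1 ha
  rcases lt_or_ge (((g+1 : ℕ) : ℤ) - (i+1 : ℕ)) 0 with hk | hk
  · rw [zpc_neg _ _ _ hk, Submodule.mem_bot] at h2
    rw [h2, map_zero, map_zero]; exact Submodule.zero_mem _
  · obtain ⟨n, hn⟩ := Int.eq_ofNat_of_zero_le hk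
    rw [hn, zpc_nat] at h2
    have h3 := map_mem_pow (Matrix.toLin' X) h2
    have h4 := omegaGd_mem R g
    rw [← zpc_nat] at h4
    have h5 := interiorR_zpc h4 h3
    have : (g : ℤ) - n = (i : ℕ) := by push_cast at hn; omega
    rwa [this, zpc_nat] at h5

/-- elements with coefficients in a subring -/
def subW {R : Type*} [CommRing R] {V : Type*} [AddCommGroup V] [Module R V] (A : Subring R)
    {κ : Type*} (e : κ → V) : Subring (ExteriorAlgebra R V) :=
  Subring.closure {x | (∃ a ∈ A, x = algebraMap R _ a) ∨ ∃ j, x = ι R (e j)}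

theorem subW_alg {R : Type*} [CommRing R] {V : Type*} [AddCommGroup V] [Module R V] (A : Subring R)
    {κ : Type*} (e : κ → V) {a : R} (ha : a ∈ A) : algebraMap R _ a ∈ subW A e :=
  Subring.subset_closure (Or.inl ⟨a, ha, rfl⟩)

theorem subW_ι {R : Type*} [CommRing R] {V : Type*} [AddCommGroup V] [Module R V] (A : Subring R)
    {κ : Type*} (e : κ → V) (j : κ) : ι R (e j) ∈ subW A e :=
  Subring.subset_closure (Or.inr ⟨j, rfl⟩)

theorem subW_ctr {R : Type*} [CommRing R] {V : Type*} [AddCommGroup V] [Module R V] (A : Subring R)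
    {κ : Type*} (e : κ → V) (d : Module.Dual R V) (hd : ∀ j, d (e j) ∈ A)
    {x : ExteriorAlgebra R V} (hx : x ∈ subW A e) : ctr d x ∈ subW A e := by
  have key : ∀ y ∈ subW A e, ctr d y ∈ subW A e → ctr d (x * y) ∈ subW A e := by
    unfold subW at hx
    induction hx using Subring.closure_induction with
    | mem x hx =>
      rcases hx with ⟨a, ha, rfl⟩ | ⟨j, rfl⟩
      · intro y hy hy'
        rw [← Algebra.smul_def, map_smul, Algebra.smul_def]
        exact Subring.mul_mem _ (subW_alg A e ha) hy'
      · intro y hy hy'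
        rw [ctr_ι_mul, Algebra.smul_def]
        exact Subring.sub_mem _ (Subring.mul_mem _ (subW_alg A e (hd j)) hy)
          (Subring.mul_mem _ (subW_ι A e j) hy')
    | zero => intro y _ _; rw [zero_mul, map_zero]; exact Subring.zero_mem _
    | one => intro y _ h; rwa [one_mul]
    | add x x' _ _ h h' =>
      intro y hy hy'
      rw [add_mul, map_add]; exact Subring.add_mem _ (h y hy hy') (h' y hy hy')
    | neg x _ h =>
      intro y hy hy'
      rw [neg_mul, map_neg]; exact Subring.neg_mem _ (h y hy hy')
    | mul x x' hx hx' h h' =>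
      intro y hy hy'
      rw [mul_assoc]
      exact h _ (Subring.mul_mem _ hx' hy) (h' y hy hy')
  have h1 : ctr d (1 : ExteriorAlgebra R V) = 0 := by
    rw [← map_one (algebraMap R _), ctr_algebraMap]
  have := key 1 (Subring.one_mem _) (by rw [h1]; exact Subring.zero_mem _)
  rwa [mul_one] at this

theorem subW_inv {R : Type*} [CommRing R] {V : Type*} [AddCommGroup V] [Module R V] (A : Subring R)
    {κ : Type*} (e : κ → V) {r : R} (hx : algebraMap R _ r ∈ subW A e) : r ∈ A := by
  have : subW A e ≤ A.comap (algebraMapInv : ExteriorAlgebra R V →ₐ[R] R).toRingHom := by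
    refine Subring.closure_le.2 ?_
    rintro _ (⟨a, ha, rfl⟩ | ⟨j, rfl⟩)
    · change algebraMapInv (algebraMap R (ExteriorAlgebra R V) a) ∈ A
      rwa [algebraMap_leftInverse]
    · change algebraMapInv (ι R (e j)) ∈ A
      have : (algebraMapInv (ι R (e j) : ExteriorAlgebra R V) : R) = 0 := by simp [algebraMapInv]
      rw [this]; exact Subring.zero_mem _
  have h := this hx
  change algebraMapInv (algebraMap R (ExteriorAlgebra R V) r) ∈ A at h
  rwa [algebraMap_leftInverse] at h

theorem subW_ιMulti {R : Type*} [CommRing R] {V : Type*} [AddCommGroup V] [Module R V]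
    (A : Subring R) {n : ℕ} (e : Fin n → V) : ιMulti R n e ∈ subW A e := by
  rw [ιMulti_apply]
  refine Subring.list_prod_mem _ fun x hx => ?_
  rw [List.mem_ofFn] at hx
  obtain ⟨j, rfl⟩ := hx
  exact subW_ι A e j

theorem subW_interiorR {R : Type*} [CommRing R] (g : ℕ) (X : Matrix (Fin g) (Fin (g+1)) R)
    (A : Subring R) (hX : ∀ i j, X i j ∈ A) {x : ExteriorAlgebra R (Fin (g+1) → R)}
    (hx : x ∈ subW A (fun j : Fin (g+1) => (Pi.single j 1 : Fin (g+1) → R))) :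
    ∀ y ∈ subW A (fun i => (Pi.basisFun R (Fin g)).coord i),
    interiorR R (Fin g → R) (ExteriorAlgebra.map (Matrix.toLin' X) x) y ∈
      subW A (fun i => (Pi.basisFun R (Fin g)).coord i) := by
  unfold subW at hx
  induction hx using Subring.closure_induction with
  | mem x hx =>
    rcases hx with ⟨a, ha, rfl⟩ | ⟨j, rfl⟩
    · intro y hy
      rw [AlgHom.commutes, interiorR_alg, Algebra.smul_def]
      exact Subring.mul_mem _ (subW_alg A _ ha) hy
    · intro y hy
      rw [map_apply_ι, ← mul_one (ι R _), interiorR_ι_mul, map_one]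
      refine subW_ctr A _ _ (fun i => ?_) hy
      simpa using hX i j
  | zero => intro y _; simp
  | one => intro y h; simpa using h
  | add x x' _ _ h h' =>
    intro y hy
    rw [map_add, map_add]; exact Subring.add_mem _ (h y hy) (h' y hy)
  | neg x _ h =>
    intro y hy
    rw [map_neg, map_neg]; exact Subring.neg_mem _ (h y hy)
  | mul x x' hx hx' h h' =>
    intro y hy
    rw [map_mul, map_mul]
    exact h _ (h' y hy)

theorem B_coeff {R : Type*} [CommRing R] (g : ℕ) (X : Matrix (Fin g) (Fin (g+1)) R)
    (A : Subring R) (hX : ∀ i j, X i j ∈ A) (k : Fin (g+1)) (q : R)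
    (hq : Bmap R g X (ι R ((Pi.basisFun R (Fin (g+1))).coord k)) = algebraMap R _ q) : q ∈ A := by
  refine subW_inv A (fun i => (Pi.basisFun R (Fin g)).coord i) ?_
  rw [← hq, Bmap_apply]
  refine subW_interiorR g X A hX ?_ _ (subW_ιMulti A _)
  rw [← mul_one (ι R _), interiorL_ι_mul, map_one]
  refine subW_ctr A _ _ (fun j => ?_) (subW_ιMulti A _)
  simp only [Module.Basis.coord_apply, Pi.basisFun_repr, Pi.single_apply]
  split_ifs
  · exact A.one_mem
  · exact A.zero_mem

end helpers_ext
open Polynomial in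
theorem nzd_poly {A : Type*} [CommRing A] (I : Ideal A) (p q : A)
    (hp : ∀ a, p * a ∈ I → a ∈ I) (f : A[X])
    (hf : (Polynomial.X * C p + C q) * f ∈ I.map C) : f ∈ I.map C := by
  rw [Ideal.mem_map_C_iff] at hf ⊢
  have key : ∀ k n, f.natDegree < n + k → f.coeff n ∈ I := by
    intro k
    induction k with
    | zero => intro n hn; rw [coeff_eq_zero_of_natDegree_lt (by simpa using hn)]; exact I.zero_mem
    | succ k ih =>
      intro n hn
      have h1 := ih (n+1) (by omega)
      have h2 := hf (n+1)
      rw [add_mul, coeff_add, mul_assoc, coeff_X_mul, coeff_C_mul, coeff_C_mul] at h2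
      exact hp _ ((I.add_mem_iff_left (I.mul_mem_left q h1)).1 h2)
  intro n
  exact key (f.natDegree + 1) n (by omega)

open Classical in
/-- substitution making the variable `s` into a fresh polynomial variable -/
noncomputable def subs {σ A : Type*} [CommRing A] (s : σ) :
    MvPolynomial σ A →ₐ[A] Polynomial (MvPolynomial σ A) :=
  MvPolynomial.aeval (fun j => if j = s then Polynomial.X else Polynomial.C (MvPolynomial.X j))

theorem subs_self {σ A : Type*} [CommRing A] (s : σ) :
    subs (A := A) s (MvPolynomial.X s) = Polynomial.X := by simp [subs]

theorem subs_ne {σ A : Type*} [CommRing A] (s j : σ) (h : j ≠ s) :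
    subs (A := A) s (MvPolynomial.X j) = Polynomial.C (MvPolynomial.X j) := by simp [subs, h]

theorem eval_subs {σ A : Type*} [CommRing A] (s : σ) (f : MvPolynomial σ A) :
    Polynomial.eval (MvPolynomial.X s) (subs s f) = f := by
  induction f using MvPolynomial.induction_on with
  | C a =>
    have : subs s (MvPolynomial.C a : MvPolynomial σ A) = Polynomial.C (MvPolynomial.C a) := by
      rw [← MvPolynomial.algebraMap_eq, AlgHom.commutes]; rfl
    rw [this]; simp
  | add p q hp hq => simp [hp, hq]
  | mul_X p j hp =>
    rw [map_mul, Polynomial.eval_mul, hp]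
    by_cases h : j = s
    · subst h; simp [subs_self]
    · simp [subs_ne _ _ h]

theorem nzd_lin {σ A : Type*} [CommRing A] (s : σ) (G : Set (MvPolynomial σ A))
    (hG : ∀ x ∈ G, subs s x = Polynomial.C x) (p q : MvPolynomial σ A)
    (hp' : subs s p = Polynomial.C p) (hq' : subs s q = Polynomial.C q)
    (hp : ∀ a, p * a ∈ Ideal.span G → a ∈ Ideal.span G) (f : MvPolynomial σ A)
    (hf : (MvPolynomial.X s * p + q) * f ∈ Ideal.span G) : f ∈ Ideal.span G := by
  have hle : (Ideal.span G).map (subs s).toRingHom ≤ (Ideal.span G).map Polynomial.C := by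
    rw [Ideal.map_span, Ideal.span_le]
    rintro _ ⟨x, hx, rfl⟩
    have : (subs s).toRingHom x = Polynomial.C x := hG x hx
    rw [this]
    exact Ideal.mem_map_of_mem _ (Ideal.subset_span hx)
  have h1 := hle (Ideal.mem_map_of_mem _ hf)
  have h2 : (subs s).toRingHom ((MvPolynomial.X s * p + q) * f) =
      (Polynomial.X * Polynomial.C p + Polynomial.C q) * subs s f := by
    change subs s _ = _
    rw [map_mul, map_add, map_mul, hp', hq', subs_self]
  rw [h2] at h1
  have h3 := nzd_poly _ _ _ hp _ h1
  have h4 := Ideal.mem_map_of_mem (Polynomial.evalRingHom (MvPolynomial.X s)) h3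
  rw [Ideal.map_map] at h4
  have h5 : (Polynomial.evalRingHom (MvPolynomial.X s : MvPolynomial σ A)).comp Polynomial.C =
    RingHom.id _ := by ext <;> simp
  rw [h5, Ideal.map_id] at h4
  simpa [eval_subs] using h4

/-- the entries of `Xv` -/
def lgen (R₀ : Type*) [CommRing R₀] (g : ℕ) (i : Fin g) : Rgen R₀ g :=
  Matrix.toLin' (Xgen R₀ g) (vgen R₀ g) i

theorem lgen_eq (R₀ : Type*) [CommRing R₀] (g : ℕ) (i : Fin g) :
    lgen R₀ g i = ∑ j, Xgen R₀ g i j * vgen R₀ g j := rfl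

/-- generators -/
def Ggen (R₀ : Type*) [CommRing R₀] (g : ℕ) (k : ℕ) (S : Finset (Fin (g+1))) : Set (Rgen R₀ g) :=
  {x | ∃ i : Fin g, i.val < k ∧ x = lgen R₀ g i} ∪ {x | ∃ j ∈ S, x = vgen R₀ g j}

theorem subs_v (R₀ : Type*) [CommRing R₀] (g : ℕ) (j : Fin (g+1))
    (s : Unit ⊕ Fin (g + 1) ⊕ (Fin g × Fin (g + 1))) (h : s ≠ Sum.inr (Sum.inl j)) :
    subs s (vgen R₀ g j) = Polynomial.C (vgen R₀ g j) := subs_ne _ _ h.symm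

theorem subs_x (R₀ : Type*) [CommRing R₀] (g : ℕ) (i : Fin g) (j : Fin (g+1))
    (s : Unit ⊕ Fin (g + 1) ⊕ (Fin g × Fin (g + 1))) (h : s ≠ Sum.inr (Sum.inr (i, j))) :
    subs s (Xgen R₀ g i j) = Polynomial.C (Xgen R₀ g i j) := subs_ne _ _ h.symm

theorem subs_l (R₀ : Type*) [CommRing R₀] (g : ℕ) (i : Fin g)
    (s : Unit ⊕ Fin (g + 1) ⊕ (Fin g × Fin (g + 1))) (hv : ∀ j, s ≠ Sum.inr (Sum.inl j))
    (h : ∀ j, s ≠ Sum.inr (Sum.inr (i, j))) :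
    subs s (lgen R₀ g i) = Polynomial.C (lgen R₀ g i) := by
  rw [lgen_eq, map_sum, map_sum]
  refine Finset.sum_congr rfl fun j _ => ?_
  rw [map_mul, map_mul, subs_v _ _ _ _ (hv j), subs_x _ _ _ _ _ (h j)]

theorem l_nzd (R₀ : Type*) [CommRing R₀] (g : ℕ) (k : Fin g) (S : Finset (Fin (g+1)))
    (m : Fin (g+1))
    (hm : ∀ a, vgen R₀ g m * a ∈ Ideal.span (Ggen R₀ g k S) → a ∈ Ideal.span (Ggen R₀ g k S))
    (a : Rgen R₀ g) (ha : lgen R₀ g k * a ∈ Ideal.span (Ggen R₀ g k S)) :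
    a ∈ Ideal.span (Ggen R₀ g k S) := by
  have hl : lgen R₀ g k = Xgen R₀ g k m * vgen R₀ g m +
      ∑ j ∈ Finset.univ.erase m, Xgen R₀ g k j * vgen R₀ g j := by
    rw [lgen_eq, ← Finset.add_sum_erase _ _ (Finset.mem_univ m)]
  rw [hl] at ha
  refine nzd_lin (Sum.inr (Sum.inr (k, m))) _ ?_ _ _ ?_ ?_ hm a ha
  · rintro x (⟨i, hi, rfl⟩ | ⟨j, hj, rfl⟩)
    · refine subs_l _ _ _ _ (by simp) ?_
      intro j hh
      simp only [Sum.inr.injEq, Prod.mk.injEq] at hh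
      rw [hh.1] at hi; exact lt_irrefl _ hi
    · exact subs_v _ _ _ _ (by simp)
  · exact subs_v _ _ _ _ (by simp)
  · rw [map_sum, map_sum]
    refine Finset.sum_congr rfl fun j hj => ?_
    rw [map_mul, map_mul, subs_v _ _ _ _ (by simp), subs_x]
    simpa using (Finset.ne_of_mem_erase hj).symm

theorem v_nzd (R₀ : Type*) [CommRing R₀] (g : ℕ) (k : ℕ) :
    ∀ (S : Finset (Fin (g+1))), k + S.card ≤ g → ∀ m ∉ S, ∀ a,
      vgen R₀ g m * a ∈ Ideal.span (Ggen R₀ g k S) → a ∈ Ideal.span (Ggen R₀ g k S) := by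
  induction k with
  | zero =>
    intro S hS m hm a ha
    have : vgen R₀ g m = MvPolynomial.X (Sum.inr (Sum.inl m)) * 1 + 0 := by
      rw [mul_one, add_zero]; rfl
    rw [this] at ha
    refine nzd_lin (Sum.inr (Sum.inl m)) _ ?_ _ _ ?_ ?_ ?_ a ha
    · rintro x (⟨i, hi, rfl⟩ | ⟨j, hj, rfl⟩)
      · exact absurd hi (Nat.not_lt_zero _)
      · refine subs_v _ _ _ _ ?_
        simp only [ne_eq, Sum.inr.injEq, Sum.inl.injEq]
        rintro rfl; exact hm hj
    · simp
    · simp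
    · intro a ha; rwa [one_mul] at ha
  | succ k ih =>
    intro S hS m hm a ha
    let K : Fin g := ⟨k, by omega⟩
    have hG : Ideal.span (Ggen R₀ g (k+1) S) =
        Ideal.span (Ggen R₀ g k S) ⊔ Ideal.span {lgen R₀ g K} := by
      rw [← Ideal.span_union]
      congr 1
      ext x
      simp only [Ggen, Set.mem_union, Set.mem_ofPred_eq, Set.mem_singleton_iff]
      constructor
      · rintro (⟨i, hi, rfl⟩ | h)
        · rcases Nat.lt_succ_iff_lt_or_eq.1 hi with hi | hi
          · exact Or.inl (Or.inl ⟨i, hi, rfl⟩)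
          · right; congr 1; exact Fin.ext hi
        · exact Or.inl (Or.inr h)
      · rintro ((⟨i, hi, rfl⟩ | h) | rfl)
        · exact Or.inl ⟨i, by omega, rfl⟩
        · exact Or.inr h
        · exact Or.inl ⟨K, Nat.lt_succ_self k, rfl⟩
    have hG' : Ideal.span (Ggen R₀ g k (insert m S)) =
        Ideal.span (Ggen R₀ g k S) ⊔ Ideal.span {vgen R₀ g m} := by
      rw [← Ideal.span_union]
      congr 1
      ext x
      simp only [Ggen, Set.mem_union, Set.mem_ofPred_eq, Set.mem_singleton_iff, Finset.mem_insert,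
        or_and_right, exists_or, exists_eq_left]
      rw [or_assoc, or_comm (a := x = vgen R₀ g m)]
    have hcard : (insert m S).card = S.card + 1 := Finset.card_insert_of_notMem hm
    obtain ⟨m', hm'⟩ : ∃ m', m' ∉ insert m S := by
      by_contra! hcon
      have : insert m S = Finset.univ := Finset.eq_univ_iff_forall.2 hcon
      rw [this, Finset.card_univ, Fintype.card_fin] at hcard
      omega
    have hl := l_nzd R₀ g K (insert m S) m' (ih _ (by omega) m' hm')
    rw [hG] at ha ⊢
    obtain ⟨u, hu, t, ht, hut⟩ := Submodule.mem_sup.1 ha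
    obtain ⟨c, rfl⟩ := Ideal.mem_span_singleton'.1 ht
    have hu' : u ∈ Ideal.span (Ggen R₀ g k (insert m S)) := hG' ▸ Ideal.mem_sup_left hu
    have hv' : vgen R₀ g m ∈ Ideal.span (Ggen R₀ g k (insert m S)) :=
      hG' ▸ Ideal.mem_sup_right (Ideal.mem_span_singleton_self _)
    have hc := hl c (by
      have := Ideal.sub_mem _ (Ideal.mul_mem_right a _ hv') hu'
      rwa [← hut, add_sub_cancel_left, mul_comm] at this)
    change c ∈ Ideal.span (Ggen R₀ g k (insert m S)) at hc
    rw [hG'] at hc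
    obtain ⟨u2, hu2, t2, ht2, hut2⟩ := Submodule.mem_sup.1 hc
    obtain ⟨c2, rfl⟩ := Ideal.mem_span_singleton'.1 ht2
    have h3 := ih S (by omega) m hm (a - lgen R₀ g K * c2) (by
      have := Ideal.add_mem _ hu (Ideal.mul_mem_right (lgen R₀ g K) _ hu2)
      convert this using 1
      rw [mul_sub, ← hut, ← hut2]; ring)
    rw [← sub_add_cancel a (lgen R₀ g K * c2)]
    exact Ideal.add_mem _ (Ideal.mem_sup_left h3) (Ideal.mem_sup_right
      (Ideal.mul_mem_right _ _ (Ideal.mem_span_singleton_self _)))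

/-- regularity of `Xv` and `v` in Koszul form, contraction `c` -/
theorem koszul_v (R₀ : Type*) [CommRing R₀] (g : ℕ) (i : ℕ) (z : LF (Rgen R₀ g) g)
    (hz : z ∈ ⋀[Rgen R₀ g]^(i+1) (Module.Dual (Rgen R₀ g) (Fin (g+1) → Rgen R₀ g)))
    (h : cv _ g (vgen R₀ g) z = 0) :
    ∃ y ∈ ⋀[Rgen R₀ g]^(i+2) (Module.Dual (Rgen R₀ g) (Fin (g+1) → Rgen R₀ g)),
      cv _ g (vgen R₀ g) y = z := by
  refine koszul (Pi.basisFun (Rgen R₀ g) (Fin (g+1))).dualBasis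
    (Module.Dual.eval _ _ (vgen R₀ g)) ?_ i z hz h
  intro k a ha
  have hw : ∀ j, Module.Dual.eval (Rgen R₀ g) _ (vgen R₀ g)
    ((Pi.basisFun (Rgen R₀ g) (Fin (g+1))).dualBasis j) = vgen R₀ g j := by
    intro j; simp
  have hs : {x | ∃ j < k, x = Module.Dual.eval (Rgen R₀ g) _ (vgen R₀ g)
    ((Pi.basisFun (Rgen R₀ g) (Fin (g+1))).dualBasis j)} = Ggen R₀ g 0 (Finset.Iio k) := by
    ext x
    simp [Ggen]
  rw [hs] at ha ⊢
  rw [hw] at ha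
  refine v_nzd R₀ g 0 (Finset.Iio k) ?_ k (by simp) a ha
  have := k.2
  simp; omega

theorem koszul_X (R₀ : Type*) [CommRing R₀] (g : ℕ) (i : ℕ) (z : LG (Rgen R₀ g) g)
    (hz : z ∈ ⋀[Rgen R₀ g]^(i+1) (Module.Dual (Rgen R₀ g) (Fin g → Rgen R₀ g)))
    (h : cXv _ g (vgen R₀ g) (Xgen R₀ g) z = 0) :
    ∃ y ∈ ⋀[Rgen R₀ g]^(i+2) (Module.Dual (Rgen R₀ g) (Fin g → Rgen R₀ g)),
      cXv _ g (vgen R₀ g) (Xgen R₀ g) y = z := by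
  refine koszul (Pi.basisFun (Rgen R₀ g) (Fin g)).dualBasis
    (Module.Dual.eval _ _ (Matrix.toLin' (Xgen R₀ g) (vgen R₀ g))) ?_ i z hz h
  intro k a ha
  have hw : ∀ j, Module.Dual.eval (Rgen R₀ g) _ (Matrix.toLin' (Xgen R₀ g) (vgen R₀ g))
    ((Pi.basisFun (Rgen R₀ g) (Fin g)).dualBasis j) = lgen R₀ g j := by
    intro j; simp [lgen]
  have hs : {x | ∃ j < k, x = Module.Dual.eval (Rgen R₀ g) _
      (Matrix.toLin' (Xgen R₀ g) (vgen R₀ g))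
      ((Pi.basisFun (Rgen R₀ g) (Fin g)).dualBasis j)} = Ggen R₀ g k ∅ := by
    ext x
    simp only [hw, Ggen]
    simp
  rw [hs] at ha ⊢
  rw [hw] at ha
  have := k.2
  exact l_nzd R₀ g k ∅ 0 (v_nzd R₀ g k ∅ (by rw [Finset.card_empty]; omega) 0 (by simp)) a ha

/-- image of contraction in degree zero -/
theorem cXv_ι (R₀ : Type*) [CommRing R₀] (g : ℕ) (c : Rgen R₀ g) :
    c ∈ Ideal.span (Ggen R₀ g g ∅) ↔
    ∃ y ∈ ⋀[Rgen R₀ g]^1 (Module.Dual (Rgen R₀ g) (Fin g → Rgen R₀ g)),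
      cXv _ g (vgen R₀ g) (Xgen R₀ g) y = algebraMap _ _ c := by
  constructor
  · intro hc
    refine Submodule.span_induction (p := fun c _ => 
      ∃ y ∈ ⋀[Rgen R₀ g]^1 (Module.Dual (Rgen R₀ g) (Fin g → Rgen R₀ g)),
      cXv _ g (vgen R₀ g) (Xgen R₀ g) y = algebraMap _ _ c) ?_ ?_ ?_ ?_ hc
    · rintro x (⟨i, hi, rfl⟩ | ⟨j, hj, rfl⟩)
      · refine ⟨ι _ ((Pi.basisFun (Rgen R₀ g) (Fin g)).coord i), ι_mem_pow _, ?_⟩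
        refine (ctr_ι _ _).trans ?_
        simp [lgen]
      · simp at hj
    · exact ⟨0, Submodule.zero_mem _, by simp⟩
    · rintro x y _ _ ⟨c, h1, h3⟩ ⟨c', h1', h3'⟩
      exact ⟨c + c', Submodule.add_mem _ h1 h1', by rw [map_add, h3, h3', map_add]⟩
    · rintro r x _ ⟨c, h1, h3⟩
      exact ⟨r • c, Submodule.smul_mem _ _ h1,
        by rw [map_smul, h3, smul_eq_mul, map_mul, Algebra.smul_def]⟩
  · rintro ⟨y, hy, h⟩
    obtain ⟨φ, rfl⟩ := mem_pow_one hy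
    have h' := (ctr_ι _ _).symm.trans h
    rw [algebraMap_inj] at h'
    rw [← h', Module.Dual.eval_apply, ← (Pi.basisFun (Rgen R₀ g) (Fin g)).sum_repr
      (Matrix.toLin' (Xgen R₀ g) (vgen R₀ g)), map_sum]
    refine Submodule.sum_mem _ fun i _ => ?_
    rw [map_smul, smul_eq_mul]
    refine Ideal.mul_mem_right _ _ (Ideal.subset_span (Or.inl ⟨i, i.2, ?_⟩))
    simp [lgen]

theorem key_zero (R₀ : Type*) [CommRing R₀] (g : ℕ)
    (φ : Module.Dual (Rgen R₀ g) (Fin (g+1) → Rgen R₀ g)) (r : Rgen R₀ g)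
    (hr : Bmap _ g (Xgen R₀ g) (ι _ φ) = algebraMap _ _ r)
    (h : r + bgen R₀ g * φ (vgen R₀ g) ∈ Ideal.span (Ggen R₀ g g ∅)) :
    φ (vgen R₀ g) ∈ Ideal.span (Ggen R₀ g g ∅) := by
  let e0 := (Pi.basisFun (Rgen R₀ g) (Fin (g+1))).coord 0
  obtain ⟨q, hq⟩ := mem_pow_zero (B_mem _ g (Xgen R₀ g) 0 (ι _ e0) (ι_mem_pow _))
  have he0 : e0 (vgen R₀ g) = vgen R₀ g 0 := by simp [e0]
  have h1 : vgen R₀ g 0 * r - φ (vgen R₀ g) * q ∈ Ideal.span (Ggen R₀ g g ∅) := by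
    rw [cXv_ι]
    refine ⟨Bmap _ g (Xgen R₀ g) (ι _ e0 * ι _ φ), B_mem _ _ _ _ _
      (ι_mul_mem_pow _ (ι_mem_pow _)), ?_⟩
    rw [← B_v]
    have : cv _ g (vgen R₀ g) (ι _ e0 * ι _ φ) =
        vgen R₀ g 0 • ι _ φ - φ (vgen R₀ g) • ι _ e0 := by
      refine (ctr_ι_mul _ _ _).trans ?_
      rw [ctr_ι, ← Algebra.commutes, ← Algebra.smul_def, Module.Dual.eval_apply,
        Module.Dual.eval_apply, he0]
    rw [this, map_sub, map_smul, map_smul, hr, hq, map_sub, map_mul, map_mul,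
      Algebra.smul_def, Algebra.smul_def]
  have h2 : (bgen R₀ g * vgen R₀ g 0 + q) * φ (vgen R₀ g) ∈ Ideal.span (Ggen R₀ g g ∅) := by
    have := Ideal.sub_mem _ (Ideal.mul_mem_left _ (vgen R₀ g 0) h) h1
    convert this using 1
    ring
  refine nzd_lin (Sum.inl ()) _ ?_ _ _ ?_ ?_ (v_nzd R₀ g g ∅ (by simp) 0 (by simp)) _ h2
  · rintro x (⟨i, hi, rfl⟩ | ⟨j, hj, rfl⟩)
    · exact subs_l _ _ _ _ (by simp) (by simp)
    · simp at hj
  · exact subs_v _ _ _ _ (by simp)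
  · let A : Subring (Rgen R₀ g) :=
      RingHom.eqLocus (subs (Sum.inl ())).toRingHom Polynomial.C
    exact B_coeff g (Xgen R₀ g) A (fun i j => subs_x R₀ g i j _ (by simp)) 0 q hq

/- Proposition 3.4: for generic data `(𝔟, v, X)` the complex `P` of Definition 3.3 is acyclic:
its homology vanishes at `P_{i+1}` for every `i ≥ 0`, i.e. in all positive degrees.  (Cycles
and boundaries are taken in the graded pieces `P_i = ⋀^i G* ⊕ ⋀^i F* ⊕ ⋀^{i-1} G*`.) -/
theorem stmt_12 (R₀ : Type*) [CommRing R₀] [IsNoetherianRing R₀] (g : ℕ) (i : ℕ)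
    (x : PM (Rgen R₀ g) g)
    (h1 : x.1 ∈ ⋀[Rgen R₀ g]^(i + 1) (Module.Dual (Rgen R₀ g) (Fin g → Rgen R₀ g)))
    (h2 : x.2.1 ∈ ⋀[Rgen R₀ g]^(i + 1) (Module.Dual (Rgen R₀ g) (Fin (g + 1) → Rgen R₀ g)))
    (h3 : x.2.2 ∈ ⋀[Rgen R₀ g]^i (Module.Dual (Rgen R₀ g) (Fin g → Rgen R₀ g)))
    (hx : dP (Rgen R₀ g) g (bgen R₀ g) (vgen R₀ g) (Xgen R₀ g) (i + 1) x = 0) :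
    ∃ y : PM (Rgen R₀ g) g,
      y.1 ∈ ⋀[Rgen R₀ g]^(i + 2) (Module.Dual (Rgen R₀ g) (Fin g → Rgen R₀ g)) ∧
      y.2.1 ∈ ⋀[Rgen R₀ g]^(i + 2) (Module.Dual (Rgen R₀ g) (Fin (g + 1) → Rgen R₀ g)) ∧
      y.2.2 ∈ ⋀[Rgen R₀ g]^(i + 1) (Module.Dual (Rgen R₀ g) (Fin g → Rgen R₀ g)) ∧
      dP (Rgen R₀ g) g (bgen R₀ g) (vgen R₀ g) (Xgen R₀ g) (i + 2) y = x := by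
  obtain ⟨x1, x2, x3⟩ := x
  simp only at h1 h2 h3
  have e1 : cXv _ g (vgen R₀ g) (Xgen R₀ g) x1 + Bmap _ g (Xgen R₀ g) x2 +
      ((-1 : Rgen R₀ g) ^ (i + 1 + 1) * bgen R₀ g) • x3 = 0 := congrArg Prod.fst hx
  have e2 : -(cv _ g (vgen R₀ g) x2) + Amap _ g (Xgen R₀ g) x3 = 0 :=
    congrArg (fun p => p.2.1) hx
  have e3 : cXv _ g (vgen R₀ g) (Xgen R₀ g) x3 = 0 := congrArg (fun p => p.2.2) hx
  have s3 : ∃ y ∈ ⋀[Rgen R₀ g]^(i+1) (Module.Dual (Rgen R₀ g) (Fin g → Rgen R₀ g)),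
      cXv _ g (vgen R₀ g) (Xgen R₀ g) y = x3 := by
    cases i with
    | succ i => exact koszul_X R₀ g i x3 h3 e3
    | zero =>
      obtain ⟨c, rfl⟩ := mem_pow_zero h3
      obtain ⟨φ, rfl⟩ := mem_pow_one h2
      obtain ⟨r, hr⟩ := mem_pow_zero (B_mem _ g (Xgen R₀ g) 0 (ι _ φ) h2)
      have hA : Amap _ g (Xgen R₀ g) (algebraMap (Rgen R₀ g) _ c) = algebraMap _ _ c :=
        AlgHom.commutes _ _
      have hc : φ (vgen R₀ g) = c := by
        have h4 : cv _ g (vgen R₀ g) (ι _ φ) = algebraMap _ _ (φ (vgen R₀ g)) := ctr_ι _ _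
        rw [hA, h4] at e2
        have := neg_add_eq_zero.1 e2
        rwa [algebraMap_inj] at this
      refine (cXv_ι R₀ g c).1 ?_
      rw [← hc]
      refine key_zero R₀ g φ r hr ?_
      rw [cXv_ι]
      refine ⟨-x1, Submodule.neg_mem _ h1, ?_⟩
      rw [hr] at e1
      rw [map_neg, hc, map_add, map_mul]
      rw [add_assoc] at e1
      rw [eq_neg_of_add_eq_zero_left e1, neg_neg, Algebra.smul_def]
      simp
  obtain ⟨y3, hy3, hy3'⟩ := s3
  have s2 := koszul_v R₀ g i (Amap _ g (Xgen R₀ g) y3 - x2)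
    (Submodule.sub_mem _ (map_mem_pow _ hy3) h2) (by
      rw [map_sub, v_A, hy3', ← e2]; abel)
  obtain ⟨y2, hy2, hy2'⟩ := s2
  have hx2 : x2 = Amap _ g (Xgen R₀ g) y3 - cv _ g (vgen R₀ g) y2 := by rw [hy2']; abel
  have s1 := koszul_X R₀ g i (x1 - Bmap _ g (Xgen R₀ g) y2 -
      ((-1 : Rgen R₀ g) ^ (i + 2 + 1) * bgen R₀ g) • y3)
    (Submodule.sub_mem _ (Submodule.sub_mem _ h1 (B_mem _ g _ _ _ hy2))
      (Submodule.smul_mem _ _ hy3)) (by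
      rw [hx2, map_sub, B_A, B_v, ← hy3'] at e1
      rw [map_sub, map_sub, map_smul, ← e1, pow_succ _ (i+2)]
      module)
  obtain ⟨y1, hy1, hy1'⟩ := s1
  refine ⟨(y1, y2, y3), hy1, hy2, hy3, ?_⟩
  refine Prod.ext ?_ (Prod.ext ?_ ?_)
  · change cXv _ g (vgen R₀ g) (Xgen R₀ g) y1 + Bmap _ g (Xgen R₀ g) y2 +
      ((-1 : Rgen R₀ g) ^ (i + 2 + 1) * bgen R₀ g) • y3 = x1
    rw [hy1']; abel
  · change -(cv _ g (vgen R₀ g) y2) + Amap _ g (Xgen R₀ g) y3 = x2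
    rw [hx2]; abel
  · exact hy3'

end
end

section
/- Let K be a field, E_0 and G_0 vector spaces of dimensions e and g over K, and 𝔓 = Sym(E_0* ⊗ G_0). With M_{-e} = ⨁_n S_{n-e} E_0* ⊗ S_n G_0 as a graded 𝔓-module, one has Tor^𝔓_{eg-e, eg}(M_{-e}, K) ≅ K (one-dimensional); equivalently, the homology H_N(0,e,eg-e) of the Koszul strand at S_0 E_0* ⊗ S_e G_0 ⊗ ⋀^{eg-e}(E_0* ⊗ G_0) is one-dimensional. -/
set_option synthInstance.maxHeartbeats 1000000
set_option maxHeartbeats 1000000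

/- The one-dimensionality of `H_N(0, e, eg - e)`, i.e. `Tor^𝔓_{eg-e, eg}(M_{-e}, K) ≅ K`.
The bigraded Koszul complex `S_a E₀* ⊗ S_c G₀ ⊗ ⋀^d (E₀* ⊗ G₀)` (with differential induced
by the identity of `E₀* ⊗ G₀`) is modelled inside the exterior algebra
`N = ⋀_S (S^{e×g})`, `S = K[y_1,…,y_e, z_1,…,z_g]`, with differential the contraction `dN`
by the dual vector `w ↦ ∑ w_{kj} y_k z_j`; the piece `S_a E₀* ⊗ S_c G₀ ⊗ ⋀^d(E₀*⊗G₀)` is the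
`K`-span `DKos a c d` of the products of a bidegree-`(a,c)` monomial with a `d`-fold exterior
monomial.  Since the complex ends `0 → S_0 E₀* ⊗ S_e G₀ ⊗ ⋀^{eg-e}(E₀*⊗G₀) → ⋯`, the
homology at `(0, e, eg-e)` is the kernel of `dN` there, and the claim is that it is
one-dimensional over `K`. -/

noncomputable section

open MvPolynomial

variable (K : Type) [Field K] (e g : ℕ)

abbrev SP (K : Type) [Field K] (e g : ℕ) := MvPolynomial (Fin e ⊕ Fin g) K

abbrev NKos (K : Type) [Field K] (e g : ℕ) :=
  ExteriorAlgebra (SP K e g) (Fin e × Fin g → SP K e g)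

/-- The Koszul dual vector `w ↦ ∑ w_{kj} y_k z_j`. -/
def theta : Module.Dual (SP K e g) (Fin e × Fin g → SP K e g) :=
  ∑ p : Fin e × Fin g, (X (Sum.inl p.1) * X (Sum.inr p.2) : SP K e g) • LinearMap.proj p

/-- The Koszul differential: contraction by `theta`. -/
def dN : NKos K e g →ₗ[SP K e g] NKos K e g :=
  CliffordAlgebra.contractLeft
    (Q := (0 : QuadraticForm (SP K e g) (Fin e × Fin g → SP K e g))) (theta K e g)

/-- The `E₀*`-degree of a monomial of `S`. -/
def wEdeg (u : (Fin e ⊕ Fin g) →₀ ℕ) : ℕ :=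
  u.sum fun s n => match s with
    | Sum.inl _ => n
    | Sum.inr _ => 0

/-- The `G₀`-degree of a monomial of `S`. -/
def wGdeg (u : (Fin e ⊕ Fin g) →₀ ℕ) : ℕ :=
  u.sum fun s n => match s with
    | Sum.inl _ => 0
    | Sum.inr _ => n

/-- The `K`-subspace `𝒩(a,c,d) = S_a E₀* ⊗ S_c G₀ ⊗ ⋀^d (E₀* ⊗ G₀)` of `NKos`. -/
def DKos (a c d : ℕ) : Submodule K (NKos K e g) :=
  Submodule.span K
    {x | ∃ u : (Fin e ⊕ Fin g) →₀ ℕ, wEdeg e g u = a ∧ wGdeg e g u = c ∧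
      ∃ v : Fin d → Fin e × Fin g,
        x = (monomial u (1 : K) : SP K e g) •
          ExteriorAlgebra.ιMulti (SP K e g) d fun t => Pi.single (v t) (1 : SP K e g)}

set_option linter.unusedSectionVars false

section generic

open CliffordAlgebra

variable {R : Type} [CommRing R] {P : Type} [DecidableEq P]

/-- basis vector in the exterior algebra -/
def eb (R : Type) [CommRing R] {P : Type} [DecidableEq P] (p : P) : ExteriorAlgebra R (P → R) :=
  ExteriorAlgebra.ι R (Pi.single p (1 : R))

/-- partial contraction -/
def dl (R : Type) [CommRing R] {P : Type} (p : P) :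
    ExteriorAlgebra R (P → R) →ₗ[R] ExteriorAlgebra R (P → R) :=
  CliffordAlgebra.contractLeft (Q := (0 : QuadraticForm R (P → R))) (LinearMap.proj p)

/-- exterior monomial -/
def lpr (R : Type) [CommRing R] {P : Type} [DecidableEq P] (l : List P) :
    ExteriorAlgebra R (P → R) := (l.map (eb R)).prod

/-- coordinates -/
def DD (R : Type) [CommRing R] {P : Type} : List P → (ExteriorAlgebra R (P → R) →ₗ[R] R)
  | [] => (ExteriorAlgebra.algebraMapInv (R := R) (M := P → R)).toLinearMap
  | p :: l => (DD R l).comp (dl R p)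

theorem DD_cons (p : P) (l : List P) (x : ExteriorAlgebra R (P → R)) :
    DD R (p :: l) x = DD R l (dl R p x) := rfl

theorem dl_eb_mul (p q : P) (x : ExteriorAlgebra R (P → R)) :
    dl R p (eb R q * x) = (if p = q then (1 : R) else 0) • x - eb R q * dl R p x := by
  have := CliffordAlgebra.contractLeft_ι_mul (Q := (0 : QuadraticForm R (P → R)))
    (d := LinearMap.proj p) (Pi.single q (1 : R)) x
  rw [LinearMap.proj_apply, Pi.single_apply] at this
  exact this

theorem dl_one (p : P) : dl R p (1 : ExteriorAlgebra R (P → R)) = 0 :=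
  CliffordAlgebra.contractLeft_one (Q := (0 : QuadraticForm R (P → R))) _

theorem dl_dl (p : P) (x : ExteriorAlgebra R (P → R)) : dl R p (dl R p x) = 0 :=
  CliffordAlgebra.contractLeft_contractLeft (Q := (0 : QuadraticForm R (P → R))) _ _

theorem dl_comm (p q : P) (x : ExteriorAlgebra R (P → R)) :
    dl R p (dl R q x) = - dl R q (dl R p x) :=
  CliffordAlgebra.contractLeft_comm (Q := (0 : QuadraticForm R (P → R))) _ _ _

theorem DD_perm {l l' : List P} (h : l.Perm l') :
    ∀ x : ExteriorAlgebra R (P → R), Associated (DD R l x) (DD R l' x) := by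
  induction h with
  | nil => intro x; rfl
  | cons p _ ih => intro x; exact ih _
  | swap p q l => 
    intro x
    simp only [DD_cons]
    rw [dl_comm, map_neg]
    exact (Associated.refl _).neg_left
  | trans _ _ ih1 ih2 => intro x; exact (ih1 x).trans (ih2 x)

theorem DD_notNodup {l : List P} (h : ¬ l.Nodup) (x : ExteriorAlgebra R (P → R)) :
    DD R l x = 0 := by
  induction l generalizing x with
  | nil => simp at h
  | cons p l ih =>
    by_cases hp : p ∈ l
    · obtain h2 := List.perm_cons_erase hp
      have := DD_perm (R := R) (h2.cons p) x
      rw [DD_cons p (p :: _), DD_cons p (l.erase p), dl_dl, map_zero] at this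
      exact this.eq_zero_iff.2 rfl
    · rw [DD_cons]
      apply ih
      intro h3
      exact h (List.nodup_cons.2 ⟨hp, h3⟩)

theorem lpr_cons (p : P) (l : List P) : lpr R (p :: l) = eb R p * lpr R l := by simp [lpr]

theorem dl_lpr_notMem {p : P} {l : List P} (h : p ∉ l) : dl R p (lpr R l) = 0 := by
  induction l with
  | nil => exact dl_one p
  | cons q l ih =>
    simp only [List.mem_cons, not_or] at h
    rw [lpr_cons, dl_eb_mul, ih h.2, if_neg h.1]; simp

theorem DD_lpr_self {l : List P} (h : l.Nodup) : DD R l (lpr R l) = 1 := by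
  induction l with
  | nil => simp [DD, lpr]
  | cons p l ih =>
    rw [List.nodup_cons] at h
    rw [DD_cons, lpr_cons, dl_eb_mul, dl_lpr_notMem h.1]
    simpa using ih h.2

theorem eb_mul_lpr {p : P} {l : List P} (h : p ∈ l) : eb R p * lpr R l = 0 := by
  induction l with
  | nil => simp at h
  | cons q l ih =>
    rw [lpr_cons, ← mul_assoc]
    by_cases hpq : p = q
    · subst hpq
      rw [eb, ExteriorAlgebra.ι_sq_zero, zero_mul]
    · have h1 : p ∈ l := by simpa [hpq] using h
      have h2 := ExteriorAlgebra.ι_add_mul_swap (R := R) (M := P → R)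
        (Pi.single p (1 : R)) (Pi.single q (1 : R))
      have h3 : eb R p * eb R q = - (eb R q * eb R p) := eq_neg_of_add_eq_zero_left h2
      rw [h3, neg_mul, mul_assoc, ih h1]; simp

/-- `x` is an exterior form of degree `d`. -/
def WS (R : Type) [CommRing R] (P : Type) [DecidableEq P] (d : ℕ) :
    Submodule R (ExteriorAlgebra R (P → R)) :=
  Submodule.span R {x | ∃ l : List P, l.length = d ∧ x = lpr R l}

theorem eb_mul_WS (p : P) {d : ℕ} {x : ExteriorAlgebra R (P → R)} (hx : x ∈ WS R P d) :
    eb R p * x ∈ WS R P (d + 1) := by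
  unfold WS at hx
  induction hx using Submodule.span_induction with
  | mem x h =>
    obtain ⟨l, hl, rfl⟩ := h
    exact Submodule.subset_span ⟨p :: l, by simp [hl], (lpr_cons _ _).symm⟩
  | zero => simp
  | add x y _ _ hx hy => rw [mul_add]; exact add_mem hx hy
  | smul a x _ hx => rw [mul_smul_comm]; exact Submodule.smul_mem _ _ hx

theorem dl_lpr_WS (p : P) (l : List P) : ∀ d, l.length = d + 1 → dl R p (lpr R l) ∈ WS R P d := by
  induction l with
  | nil => intro d h; simp at h
  | cons q l ih =>
    intro d h
    rw [lpr_cons, dl_eb_mul]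
    simp only [List.length_cons, Nat.add_right_cancel_iff] at h
    refine sub_mem (Submodule.smul_mem _ _ (Submodule.subset_span ⟨l, h, rfl⟩)) ?_
    cases d with
    | zero =>
      rw [List.length_eq_zero_iff] at h
      subst h
      have : dl R p (lpr R []) = 0 := dl_one p
      rw [this]; simp
    | succ d => exact eb_mul_WS q (ih d h)

theorem dl_WS (p : P) {d : ℕ} {x : ExteriorAlgebra R (P → R)} (hx : x ∈ WS R P (d + 1)) :
    dl R p x ∈ WS R P d := by
  unfold WS at hx
  induction hx using Submodule.span_induction with
  | mem x h =>
    obtain ⟨l, hl, rfl⟩ := h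
    exact dl_lpr_WS p l d hl
  | zero => simp
  | add x y _ _ hx hy => rw [map_add]; exact add_mem hx hy
  | smul a x _ hx => rw [map_smul]; exact Submodule.smul_mem _ _ hx

/-- iterated projection -/
def PP (R : Type) [CommRing R] {P : Type} [DecidableEq P] :
    List P → (ExteriorAlgebra R (P → R) →ₗ[R] ExteriorAlgebra R (P → R))
  | [] => LinearMap.id
  | p :: l => (PP R l).comp ((dl R p).comp (LinearMap.mulLeft R (eb R p)))

theorem PP_cons (p : P) (l : List P) (x : ExteriorAlgebra R (P → R)) :
    PP R (p :: l) x = PP R l (dl R p (eb R p * x)) := rfl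

theorem PP_fix {l : List P} {x : ExteriorAlgebra R (P → R)} (h : ∀ p, dl R p x = 0) :
    PP R l x = x := by
  induction l with
  | nil => rfl
  | cons p l ih => rw [PP_cons, dl_eb_mul, h, if_pos rfl]; simpa using ih

theorem PP_lpr {l m : List P} (q : P) (hq : q ∈ m) (hq' : q ∈ l) :
    PP R m (lpr R l) = 0 := by
  induction m with
  | nil => simp at hq
  | cons p m ih =>
    rw [PP_cons]
    by_cases hp : p ∈ l
    · rw [eb_mul_lpr hp]; simp
    · rw [dl_eb_mul, dl_lpr_notMem hp, if_pos rfl]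
      have : q ∈ m := by
        rcases List.mem_cons.1 hq with h | h
        · exact absurd (h ▸ hq') hp
        · exact h
      simpa using ih this

theorem eq_zero_of_dl [Fintype P] {d : ℕ} {x : ExteriorAlgebra R (P → R)}
    (hx : x ∈ WS R P (d + 1)) (h : ∀ p, dl R p x = 0) : x = 0 := by
  rw [← PP_fix (l := (Finset.univ : Finset P).toList) h]
  clear h
  unfold WS at hx
  induction hx using Submodule.span_induction with
  | mem x h =>
    obtain ⟨l, hl, rfl⟩ := h
    cases l with
    | nil => simp at hl
    | cons q l => exact PP_lpr q (by simp) (by simp)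
  | zero => simp
  | add x y _ _ hx hy => rw [map_add, hx, hy, add_zero]
  | smul a x _ hx => rw [map_smul, hx, smul_zero]

theorem eq_zero_of_DD [Fintype P] {d : ℕ} {x : ExteriorAlgebra R (P → R)}
    (hx : x ∈ WS R P d) (h : ∀ l : List P, l.length = d → DD R l x = 0) : x = 0 := by
  induction d generalizing x with
  | zero =>
    have h0 := h [] rfl
    have : ∃ r : R, x = algebraMap R _ r := by
      clear h h0
      unfold WS at hx
      induction hx using Submodule.span_induction with
      | mem x h =>
        obtain ⟨l, hl, rfl⟩ := h
        rw [List.length_eq_zero_iff] at hl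
        subst hl
        exact ⟨1, by simp [lpr]⟩
      | zero => exact ⟨0, by simp⟩
      | add x y _ _ hx hy =>
        obtain ⟨a, rfl⟩ := hx
        obtain ⟨b, rfl⟩ := hy
        exact ⟨a + b, by simp⟩
      | smul a x _ hx =>
        obtain ⟨b, rfl⟩ := hx
        exact ⟨a * b, by rw [map_mul, Algebra.smul_def]⟩
    obtain ⟨r, rfl⟩ := this
    have h1 : r = 0 := by
      have := ExteriorAlgebra.algebraMap_leftInverse (R := R) (P → R) r
      rw [← this]; exact h0
    rw [h1, map_zero]
  | succ d ih =>
    apply eq_zero_of_dl hx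
    intro p
    apply ih (dl_WS p hx)
    intro l hl
    exact h (p :: l) (by simp [hl])

theorem eq_zero_of_DD' [Fintype P] {d : ℕ} {x : ExteriorAlgebra R (P → R)}
    (hx : x ∈ WS R P d) (h : ∀ T : Finset P, T.card = d → DD R T.toList x = 0) : x = 0 := by
  apply eq_zero_of_DD hx
  intro l hl
  by_cases hn : l.Nodup
  · have h1 := h l.toFinset (by rw [List.toFinset_card_of_nodup hn, hl])
    have h2 := DD_perm (R := R) (List.toFinset_toList hn) x
    exact h2.eq_zero_iff.1 h1
  · exact DD_notNodup hn x

/-- integral exterior forms of degree `d`. -/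
def WZ (R : Type) [CommRing R] (P : Type) [DecidableEq P] (d : ℕ) :
    AddSubgroup (ExteriorAlgebra R (P → R)) :=
  AddSubgroup.closure {x | ∃ l : List P, l.length = d ∧ x = lpr R l}

theorem eb_mul_WZ (p : P) {d : ℕ} {x : ExteriorAlgebra R (P → R)} (hx : x ∈ WZ R P d) :
    eb R p * x ∈ WZ R P (d + 1) := by
  unfold WZ at hx
  induction hx using AddSubgroup.closure_induction with
  | mem x h =>
    obtain ⟨l, hl, rfl⟩ := h
    exact AddSubgroup.subset_closure ⟨p :: l, by simp [hl], (lpr_cons _ _).symm⟩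
  | zero => rw [mul_zero]; exact zero_mem _
  | add x y _ _ hx hy => rw [mul_add]; exact add_mem hx hy
  | neg x _ hx => rw [mul_neg]; exact neg_mem hx

theorem dl_lpr_WZ (p : P) (l : List P) : ∀ d, l.length = d + 1 → dl R p (lpr R l) ∈ WZ R P d := by
  induction l with
  | nil => intro d h; simp at h
  | cons q l ih =>
    intro d h
    rw [lpr_cons, dl_eb_mul]
    simp only [List.length_cons, Nat.add_right_cancel_iff] at h
    refine sub_mem ?_ ?_
    · split_ifs
      · rw [one_smul]; exact AddSubgroup.subset_closure ⟨l, h, rfl⟩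
      · rw [zero_smul]; exact zero_mem _
    cases d with
    | zero =>
      rw [List.length_eq_zero_iff] at h
      subst h
      have : dl R p (lpr R []) = 0 := dl_one p
      rw [this, mul_zero]; exact zero_mem _
    | succ d => exact eb_mul_WZ q (ih d h)

theorem dl_WZ (p : P) {d : ℕ} {x : ExteriorAlgebra R (P → R)} (hx : x ∈ WZ R P (d + 1)) :
    dl R p x ∈ WZ R P d := by
  unfold WZ at hx
  induction hx using AddSubgroup.closure_induction with
  | mem x h =>
    obtain ⟨l, hl, rfl⟩ := h
    exact dl_lpr_WZ p l d hl
  | zero => rw [map_zero]; exact zero_mem _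
  | add x y _ _ hx hy => rw [map_add]; exact add_mem hx hy
  | neg x _ hx => rw [map_neg]; exact neg_mem hx

theorem DD_WZ (l : List P) : ∀ {x : ExteriorAlgebra R (P → R)}, x ∈ WZ R P l.length →
    ∃ n : ℤ, DD R l x = (n : R) := by
  induction l with
  | nil =>
    intro x hx
    unfold WZ at hx
    induction hx using AddSubgroup.closure_induction with
    | mem x h =>
      obtain ⟨l, hl, rfl⟩ := h
      rw [List.length_nil, List.length_eq_zero_iff] at hl
      subst hl
      exact ⟨1, by simp [DD, lpr]⟩
    | zero => exact ⟨0, by simp⟩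
    | add x y _ _ hx hy =>
      obtain ⟨a, ha⟩ := hx
      obtain ⟨b, hb⟩ := hy
      exact ⟨a + b, by simp [ha, hb]⟩
    | neg x _ hx =>
      obtain ⟨a, ha⟩ := hx
      exact ⟨-a, by simp [ha]⟩
  | cons p l ih =>
    intro x hx
    exact ih (dl_WZ p hx)

end generic

section specific

variable {K : Type} [Field K] {e g : ℕ}

theorem wEdeg_eq (u : (Fin e ⊕ Fin g) →₀ ℕ) : wEdeg e g u = ∑ k, u (Sum.inl k) := by
  unfold wEdeg
  rw [Finsupp.sum_fintype _ _ (by rintro (i | i) <;> rfl), Fintype.sum_sum_type]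
  simp

theorem wGdeg_eq (u : (Fin e ⊕ Fin g) →₀ ℕ) : wGdeg e g u = ∑ k, u (Sum.inr k) := by
  unfold wGdeg
  rw [Finsupp.sum_fintype _ _ (by rintro (i | i) <;> rfl), Fintype.sum_sum_type]
  simp

theorem DKos_eq (a c d : ℕ) : DKos K e g a c d = Submodule.span K
    {x | ∃ u : (Fin e ⊕ Fin g) →₀ ℕ, wEdeg e g u = a ∧ wGdeg e g u = c ∧
      ∃ l : List (Fin e × Fin g), l.length = d ∧
        x = (monomial u (1 : K) : SP K e g) • lpr (SP K e g) l} := by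
  unfold DKos
  congr 1
  ext x
  constructor
  · rintro ⟨u, h1, h2, v, rfl⟩
    refine ⟨u, h1, h2, List.ofFn v, by simp, ?_⟩
    rw [ExteriorAlgebra.ιMulti_apply, lpr, List.map_ofFn]
    rfl
  · rintro ⟨u, h1, h2, l, rfl, rfl⟩
    refine ⟨u, h1, h2, l.get, ?_⟩
    rw [ExteriorAlgebra.ιMulti_apply, lpr]
    congr 2
    conv_lhs => rw [← List.ofFn_get l]
    rw [List.map_ofFn]
    rfl

theorem mem_DKos_lpr {a c : ℕ} (u : (Fin e ⊕ Fin g) →₀ ℕ) (h1 : wEdeg e g u = a)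
    (h2 : wGdeg e g u = c) (l : List (Fin e × Fin g)) :
    (monomial u (1 : K) : SP K e g) • lpr (SP K e g) l ∈ DKos K e g a c l.length := by
  rw [DKos_eq]
  exact Submodule.subset_span ⟨u, h1, h2, l, rfl, rfl⟩

theorem mem_DKos_WZ {a c d : ℕ} (u : (Fin e ⊕ Fin g) →₀ ℕ) (h1 : wEdeg e g u = a)
    (h2 : wGdeg e g u = c) {x : NKos K e g} (hx : x ∈ WZ (SP K e g) (Fin e × Fin g) d) :
    (monomial u (1 : K) : SP K e g) • x ∈ DKos K e g a c d := by
  unfold WZ at hx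
  induction hx using AddSubgroup.closure_induction with
  | mem x h =>
    obtain ⟨l, rfl, rfl⟩ := h
    exact mem_DKos_lpr u h1 h2 l
  | zero => rw [smul_zero]; exact zero_mem _
  | add x y _ _ hx hy => rw [smul_add]; exact add_mem hx hy
  | neg x _ hx => rw [smul_neg]; exact neg_mem hx

theorem DKos_WS {a c d : ℕ} {x : NKos K e g} (hx : x ∈ DKos K e g a c d) :
    x ∈ WS (SP K e g) (Fin e × Fin g) d := by
  rw [DKos_eq] at hx
  induction hx using Submodule.span_induction with
  | mem x h =>
    obtain ⟨u, h1, h2, l, hl, rfl⟩ := h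
    exact Submodule.smul_mem _ _ (Submodule.subset_span ⟨l, hl, rfl⟩)
  | zero => exact zero_mem _
  | add x y _ _ hx hy => exact add_mem hx hy
  | smul a x _ hx =>
    rw [← algebraMap_smul (SP K e g) a x]; exact Submodule.smul_mem _ _ hx

theorem dl_DKos (p : Fin e × Fin g) {a c d : ℕ} {x : NKos K e g}
    (hx : x ∈ DKos K e g a c (d + 1)) : dl (SP K e g) p x ∈ DKos K e g a c d := by
  rw [DKos_eq] at hx
  induction hx using Submodule.span_induction with
  | mem x h =>
    obtain ⟨u, h1, h2, l, hl, rfl⟩ := h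
    rw [map_smul]
    exact mem_DKos_WZ u h1 h2 (dl_lpr_WZ p l d hl)
  | zero => rw [map_zero]; exact zero_mem _
  | add x y _ _ hx hy => rw [map_add]; exact add_mem hx hy
  | smul a x _ hx =>
    rw [← algebraMap_smul (SP K e g) a x, map_smul, algebraMap_smul]
    exact Submodule.smul_mem _ _ hx

theorem X_DKos (j : Fin g) {a c d : ℕ} {x : NKos K e g}
    (hx : x ∈ DKos K e g a c d) :
    (X (Sum.inr j) : SP K e g) • x ∈ DKos K e g a (c + 1) d := by
  rw [DKos_eq] at hx
  induction hx using Submodule.span_induction with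
  | mem x h =>
    obtain ⟨u, h1, h2, l, rfl, rfl⟩ := h
    rw [smul_smul, X, monomial_mul, one_mul]
    apply mem_DKos_lpr
    · rw [← h1, wEdeg_eq, wEdeg_eq]
      simp
    · rw [← h2, wGdeg_eq, wGdeg_eq]
      simp [Finsupp.single_apply, Finset.sum_add_distrib, add_comm]
  | zero => rw [smul_zero]; exact zero_mem _
  | add x y _ _ hx hy => rw [smul_add]; exact add_mem hx hy
  | smul a x _ hx =>
    rw [smul_comm]
    exact Submodule.smul_mem _ _ hx

/-- the contraction in row `k` -/
def tk (K : Type) [Field K] (e g : ℕ) (k : Fin e) : NKos K e g →ₗ[SP K e g] NKos K e g :=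
  ∑ j : Fin g, (X (Sum.inr j) : SP K e g) • dl (SP K e g) (k, j)

theorem tk_apply (k : Fin e) (x : NKos K e g) :
    tk K e g k x = ∑ j : Fin g, (X (Sum.inr j) : SP K e g) • dl (SP K e g) (k, j) x := by
  simp [tk]

theorem tk_eq (k : Fin e) (x : NKos K e g) :
    tk K e g k x = CliffordAlgebra.contractLeft
      (Q := (0 : QuadraticForm (SP K e g) (Fin e × Fin g → SP K e g)))
      (∑ j : Fin g, (X (Sum.inr j) : SP K e g) • LinearMap.proj (k, j)) x := by
  rw [tk_apply, map_sum, LinearMap.sum_apply]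
  refine Finset.sum_congr rfl fun j _ => ?_
  rw [map_smul]; rfl

theorem tk_tk (k : Fin e) (x : NKos K e g) : tk K e g k (tk K e g k x) = 0 := by
  rw [tk_eq, tk_eq]
  exact CliffordAlgebra.contractLeft_contractLeft (Q := 0) _ _

theorem tk_comm (k k' : Fin e) (x : NKos K e g) :
    tk K e g k (tk K e g k' x) = - tk K e g k' (tk K e g k x) := by
  rw [tk_eq, tk_eq, tk_eq k', tk_eq k]
  exact CliffordAlgebra.contractLeft_comm (Q := 0) _ _ _

theorem dN_eq (x : NKos K e g) :
    dN K e g x = ∑ k : Fin e, (X (Sum.inl k) : SP K e g) • tk K e g k x := by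
  unfold dN theta
  rw [map_sum, LinearMap.sum_apply, Fintype.sum_prod_type]
  refine Finset.sum_congr rfl fun k _ => ?_
  rw [tk_apply, Finset.smul_sum]
  refine Finset.sum_congr rfl fun j _ => ?_
  rw [map_smul, mul_smul]; rfl

theorem tk_DKos (k : Fin e) {a c d : ℕ} {x : NKos K e g}
    (hx : x ∈ DKos K e g a c (d + 1)) : tk K e g k x ∈ DKos K e g a (c + 1) d := by
  rw [tk_apply]
  exact sum_mem fun j _ => X_DKos j (dl_DKos _ hx)

/-- iterated contraction -/
def tl (K : Type) [Field K] (e g : ℕ) : List (Fin e) → NKos K e g → NKos K e g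
  | [], x => x
  | k :: l, x => tk K e g k (tl K e g l x)

theorem tk_tl {k : Fin e} {l : List (Fin e)} (h : k ∈ l) (x : NKos K e g) :
    tk K e g k (tl K e g l x) = 0 := by
  induction l with
  | nil => simp at h
  | cons q l ih =>
    rw [tl]
    by_cases hq : k = q
    · subst hq; exact tk_tk _ _
    · rw [tk_comm, ih (by simpa [hq] using h)]; simp

theorem tl_DKos (l : List (Fin e)) {a c d : ℕ} {x : NKos K e g}
    (hx : x ∈ DKos K e g a c (d + l.length)) : tl K e g l x ∈ DKos K e g a (c + l.length) d := by
  induction l generalizing d with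
  | nil => exact hx
  | cons k l ih =>
    rw [tl, List.length_cons, ← add_assoc]
    apply tk_DKos
    apply ih
    rw [List.length_cons] at hx
    rwa [add_assoc, add_comm 1]

/-- the row-`k` relation among coordinates of a contraction -/
theorem DD_tk (k : Fin e) (i : Fin g) (T : List (Fin e × Fin g)) (x : NKos K e g)
    (hT : ∀ j, j ≠ i → (k, j) ∈ T) :
    DD (SP K e g) T (tk K e g k x) =
      X (Sum.inr i) * DD (SP K e g) ((k, i) :: T) x := by
  rw [tk_apply, map_sum, Finset.sum_eq_single i]
  · rw [map_smul]; rfl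
  · intro j _ hj
    rw [map_smul, ← DD_cons, DD_notNodup, smul_zero]
    intro h
    exact (List.nodup_cons.1 h).1 (hT j hj)
  · simp

theorem DD_tl (l : List (Fin e)) (i : Fin g) (T : List (Fin e × Fin g)) (x : NKos K e g)
    (hT : ∀ k j, j ≠ i → (k, j) ∈ T) :
    DD (SP K e g) T (tl K e g l x) =
      X (Sum.inr i) ^ l.length * DD (SP K e g) ((l.map fun k => (k, i)).reverse ++ T) x := by
  induction l generalizing T with
  | nil => simp [tl]
  | cons k l ih =>
    rw [tl, DD_tk k i T _ (fun j hj => hT k j hj), ih]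
    · simp [pow_succ]; ring
    · intro k' j hj
      exact List.mem_cons_of_mem _ (hT k' j hj)

/-- complement of the graph of `f` -/
def Tf (f : Fin e → Fin g) : Finset (Fin e × Fin g) :=
  Finset.univ.filter fun p => p.2 ≠ f p.1

theorem mem_Tf (f : Fin e → Fin g) (p : Fin e × Fin g) : p ∈ Tf f ↔ p.2 ≠ f p.1 := by simp [Tf]

theorem card_Tf (f : Fin e → Fin g) : (Tf f).card = e * g - e := by
  have h1 : (Tf f)ᶜ = Finset.univ.image fun k => (k, f k) := by
    ext ⟨a, b⟩
    simp [Tf, eq_comm]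
  have h2 : ((Tf f)ᶜ).card = e := by
    rw [h1, Finset.card_image_of_injective]
    · simp
    · intro a b h; simpa using congrArg Prod.fst h
  have h3 := Finset.card_add_card_compl (Tf f)
  rw [h2] at h3
  simp only [Fintype.card_prod, Fintype.card_fin] at h3
  omega

theorem exists_elt (i : Fin g) :
    ∃ x ∈ DKos K e g 0 e (e * g - e), dN K e g x = 0 ∧
      Associated (DD (SP K e g) (Tf fun _ => i).toList x) (X (Sum.inr i) ^ e) := by
  set l := List.finRange e with hl
  set T := (Tf fun _ : Fin e => i).toList with hT
  set L := (l.map fun k => (k, i)).reverse ++ T with hL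
  have hnod : L.Nodup := by
    rw [hL, List.nodup_append']
    refine ⟨?_, Finset.nodup_toList _, ?_⟩
    · rw [List.nodup_reverse]
      apply List.Nodup.map _ (List.nodup_finRange e)
      intro a b h; simpa using congrArg Prod.fst h
    · intro p h1 h2
      rw [hT, Finset.mem_toList, mem_Tf] at h2
      simp only [List.mem_reverse, List.mem_map] at h1
      obtain ⟨k, _, rfl⟩ := h1
      exact h2 rfl
  refine ⟨tl K e g l (lpr (SP K e g) L), ?_, ?_, ?_⟩
  · have h1 : lpr (SP K e g) L ∈ DKos K e g 0 0 L.length := by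
      have := mem_DKos_lpr (K := K) (a := 0) (c := 0) (0 : (Fin e ⊕ Fin g) →₀ ℕ)
        (by simp [wEdeg_eq]) (by simp [wGdeg_eq]) L
      rwa [monomial_zero', C_1, one_smul] at this
    have h2 : L.length = (e * g - e) + l.length := by
      rw [hL, hT]; simp [card_Tf, add_comm]
    rw [h2] at h1
    have := tl_DKos l h1
    simpa [hl] using this
  · rw [dN_eq]
    apply Finset.sum_eq_zero
    intro k _
    rw [tk_tl (by simp [hl]), smul_zero]
  · rw [DD_tl l i T _ (by intro k j hj; simpa [hT, mem_Tf] using hj), DD_lpr_self (by rw [← hL]; exact hnod), mul_one]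
    simp [hl]


/-- polynomials in the `z`-variables, homogeneous of degree `c` -/
def Cz (K : Type) [Field K] (e g c : ℕ) : Submodule K (SP K e g) :=
  Submodule.span K {q | ∃ u : (Fin e ⊕ Fin g) →₀ ℕ, wEdeg e g u = 0 ∧ wGdeg e g u = c ∧
    q = monomial u 1}

theorem DD_mem_Cz {c : ℕ} {l : List (Fin e × Fin g)} {x : NKos K e g}
    (hx : x ∈ DKos K e g 0 c l.length) : DD (SP K e g) l x ∈ Cz K e g c := by
  rw [DKos_eq] at hx
  induction hx using Submodule.span_induction with
  | mem x h =>
    obtain ⟨u, h1, h2, l', hl, rfl⟩ := h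
    rw [map_smul]
    obtain ⟨n, hn⟩ := DD_WZ (R := SP K e g) l (x := lpr (SP K e g) l')
      (by unfold WZ; exact AddSubgroup.subset_closure ⟨l', hl, rfl⟩)
    rw [hn, smul_eq_mul, mul_comm, ← zsmul_eq_mul]
    have hu : (monomial u 1 : SP K e g) ∈ Cz K e g c :=
      Submodule.subset_span ⟨u, h1, h2, rfl⟩
    exact zsmul_mem hu n
  | zero => rw [map_zero]; exact zero_mem _
  | add x y _ _ hx hy => rw [map_add]; exact add_mem hx hy
  | smul a x _ hx =>
    rw [← algebraMap_smul (SP K e g) a x, map_smul, algebraMap_smul]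
    exact Submodule.smul_mem _ _ hx

/-- specialise the `y`-variables to the `k`-th unit vector -/
def psi (K : Type) [Field K] (e g : ℕ) (k : Fin e) : SP K e g →ₐ[K] SP K e g :=
  aeval (Sum.elim (Pi.single k (1 : SP K e g)) fun j => X (Sum.inr j))

theorem psi_fix (k : Fin e) {c : ℕ} {q : SP K e g} (hq : q ∈ Cz K e g c) :
    psi K e g k q = q := by
  unfold Cz at hq
  induction hq using Submodule.span_induction with
  | mem x h =>
    obtain ⟨u, h1, h2, rfl⟩ := h
    rw [wEdeg_eq, Finset.sum_eq_zero_iff] at h1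
    rw [psi, aeval_monomial, monomial_eq, map_one, C_1]
    congr 1
    apply Finsupp.prod_congr
    rintro (i | i) hi
    · exact absurd (h1 i (Finset.mem_univ _)) (by simpa using hi)
    · rfl
  | zero => rw [map_zero]
  | add x y _ _ hx hy => rw [map_add, hx, hy]
  | smul a x _ hx => rw [map_smul, hx]

theorem row_rel {c : ℕ} {L : List (Fin e × Fin g)} {x : NKos K e g}
    (hx : x ∈ DKos K e g 0 c (L.length + 1)) (h0 : dN K e g x = 0) (k : Fin e) :
    ∑ j : Fin g, X (Sum.inr j) * DD (SP K e g) ((k, j) :: L) x = 0 := by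
  have h1 : ∑ k' : Fin e, (X (Sum.inl k') : SP K e g) *
      ∑ j : Fin g, X (Sum.inr j) * DD (SP K e g) ((k', j) :: L) x = 0 := by
    have := congrArg (DD (SP K e g) L) h0
    rw [dN_eq, map_zero, map_sum] at this
    rw [← this]
    refine Finset.sum_congr rfl fun k' _ => ?_
    rw [map_smul, smul_eq_mul, tk_apply, map_sum]
    congr 1
    refine Finset.sum_congr rfl fun j _ => ?_
    rw [map_smul, smul_eq_mul]; rfl
  have h2 := congrArg (psi K e g k) h1
  rw [map_sum, map_zero, Finset.sum_eq_single k] at h2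
  · rw [map_mul, map_sum] at h2
    have h3 : psi K e g k (X (Sum.inl k)) = 1 := by simp [psi]
    rw [h3, one_mul] at h2
    rw [← h2]
    refine Finset.sum_congr rfl fun j _ => ?_
    rw [map_mul, psi_fix (c := c) k (DD_mem_Cz (by simpa using hx))]
    congr 1
    simp [psi]
  · intro k' _ hk
    have h3 : psi K e g k (X (Sum.inl k')) = 0 := by simp [psi, hk]
    rw [map_mul, h3, zero_mul]
  · simp

theorem DD_full_row {c : ℕ} {T : Finset (Fin e × Fin g)} {x : NKos K e g}
    (hx : x ∈ DKos K e g 0 c T.card) (h0 : dN K e g x = 0) (k : Fin e) (i : Fin g)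
    (hT : ∀ j, (k, j) ∈ T) : DD (SP K e g) T.toList x = 0 := by
  have hp : ((k, i) :: (T.erase (k, i)).toList).Perm T.toList := by
    have := Finset.toList_insert (Finset.notMem_erase (k, i) T)
    rw [Finset.insert_erase (hT i)] at this
    exact this.symm
  have hlen : (T.erase (k, i)).toList.length + 1 = T.card := by
    rw [Finset.length_toList, Finset.card_erase_add_one (hT i)]
  have h1 := row_rel (L := (T.erase (k, i)).toList) (by rwa [hlen]) h0 k
  rw [Finset.sum_eq_single i] at h1
  · have h2 := (mul_eq_zero.1 h1).resolve_left (X_ne_zero _)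
    exact ((DD_perm hp x).eq_zero_iff).1 h2
  · intro j _ hj
    rw [DD_notNodup, mul_zero]
    intro h
    refine (List.nodup_cons.1 h).1 ?_
    simp [hT, hj]
  · simp

theorem DD_step {c : ℕ} {x : NKos K e g}
    (hx : x ∈ DKos K e g 0 c (e * g - e)) (h0 : dN K e g x = 0) (f : Fin e → Fin g)
    (k : Fin e) (i : Fin g) :
    Associated (X (Sum.inr i) * DD (SP K e g) (Tf f).toList x)
      (X (Sum.inr (f k)) * DD (SP K e g) (Tf (Function.update f k i)).toList x) := by
  by_cases hi : i = f k
  · subst hi; simp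
  have hm : (k, i) ∈ Tf f := by rw [mem_Tf]; exact hi
  set E := (Tf f).erase (k, i) with hE
  have hn : (k, f k) ∉ E := by simp [hE, mem_Tf]
  have hp1 : ((k, i) :: E.toList).Perm (Tf f).toList := by
    have := Finset.toList_insert (Finset.notMem_erase (k, i) (Tf f))
    rw [Finset.insert_erase hm] at this
    exact this.symm
  have hp2 : ((k, f k) :: E.toList).Perm (Tf (Function.update f k i)).toList := by
    have := Finset.toList_insert hn
    have h2 : insert (k, f k) E = Tf (Function.update f k i) := by
      ext ⟨a, b⟩
      simp only [hE, Finset.mem_insert, Finset.mem_erase, mem_Tf, Prod.mk.injEq, ne_eq]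
      by_cases ha : a = k
      · subst ha
        simp only [true_and, Function.update_self]
        constructor
        · rintro (h | h)
          · rw [h]; exact fun h => hi h.symm
          · exact h.1
        · intro h
          by_cases hb : b = f a
          · exact Or.inl hb
          · exact Or.inr ⟨h, hb⟩
      · simp [ha]
    rw [h2] at this
    exact this.symm
  have hlen : E.toList.length + 1 = e * g - e := by
    rw [Finset.length_toList, Finset.card_erase_add_one hm, card_Tf]
  have h1 := row_rel (L := E.toList) (by rwa [hlen]) h0 k
  rw [Fintype.sum_eq_add i (f k) hi] at h1
  · have h2 := (DD_perm (R := SP K e g) hp1 x).mul_left (X (Sum.inr i))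
    have h3 := (DD_perm (R := SP K e g) hp2 x).mul_left (X (Sum.inr (f k)))
    refine h2.symm.trans (Associated.trans ?_ h3)
    rw [eq_neg_of_add_eq_zero_left h1]
    exact (Associated.refl _).neg_left
  · rintro j ⟨hj1, hj2⟩
    rw [DD_notNodup, mul_zero]
    intro h
    refine (List.nodup_cons.1 h).1 ?_
    simp [hE, mem_Tf, hj1, hj2]

theorem DD_chain {c : ℕ} {x : NKos K e g}
    (hx : x ∈ DKos K e g 0 c (e * g - e)) (h0 : dN K e g x = 0) (f h : Fin e → Fin g)
    (s : Finset (Fin e)) :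
    Associated ((∏ k ∈ s, X (Sum.inr (h k))) * DD (SP K e g) (Tf f).toList x)
      ((∏ k ∈ s, X (Sum.inr (f k))) * DD (SP K e g) (Tf (s.piecewise h f)).toList x) := by
  induction s using Finset.induction_on with
  | empty => simp
  | insert k s hk ih =>
    rw [Finset.prod_insert hk, Finset.prod_insert hk, Finset.piecewise_insert]
    have h1 := ih.mul_left (X (Sum.inr (h k)))
    have h2 := (DD_step hx h0 (s.piecewise h f) k (h k)).mul_left (∏ k ∈ s, X (Sum.inr (f k)))
    rw [Finset.piecewise_eq_of_notMem s h f hk] at h2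
    rw [mul_assoc]
    refine h1.trans ?_
    rw [mul_left_comm]
    refine h2.trans ?_
    rw [mul_left_comm, mul_assoc]

theorem DD_all {c : ℕ} {x : NKos K e g}
    (hx : x ∈ DKos K e g 0 c (e * g - e)) (h0 : dN K e g x = 0) (f h : Fin e → Fin g) :
    Associated ((∏ k, X (Sum.inr (h k))) * DD (SP K e g) (Tf f).toList x)
      ((∏ k, X (Sum.inr (f k))) * DD (SP K e g) (Tf h).toList x) := by
  have := DD_chain hx h0 f h Finset.univ
  rwa [Finset.piecewise_univ] at this

theorem eq_zero_of_Tf {c : ℕ} {x : NKos K e g} (hg : 0 < g)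
    (hx : x ∈ DKos K e g 0 c (e * g - e)) (h0 : dN K e g x = 0) (f : Fin e → Fin g)
    (hf : DD (SP K e g) (Tf f).toList x = 0) : x = 0 := by
  have hall : ∀ h : Fin e → Fin g, DD (SP K e g) (Tf h).toList x = 0 := by
    intro h
    have h1 := DD_all hx h0 f h
    rw [hf, mul_zero] at h1
    have h2 := h1.eq_zero_iff.1 rfl
    refine (mul_eq_zero.1 h2).resolve_left ?_
    refine Finset.prod_ne_zero_iff.2 ?_
    intro k _
    exact X_ne_zero _
  apply eq_zero_of_DD' (DKos_WS hx)
  intro T hT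
  by_cases hrow : ∃ k, ∀ j, (k, j) ∈ T
  · obtain ⟨k, hk⟩ := hrow
    exact DD_full_row (by rwa [hT]) h0 k ⟨0, hg⟩ hk
  · push Not at hrow
    choose h hh using hrow
    have hs : T ⊆ Tf h := by
      rintro ⟨a, b⟩ hab
      rw [mem_Tf]
      rintro hb
      simp only at hb
      subst hb
      exact hh a hab
    rw [Finset.eq_of_subset_of_card_le hs (by rw [card_Tf, hT])]
    exact hall h

theorem Cz_totalDegree {c : ℕ} {q : SP K e g} (hq : q ∈ Cz K e g c) : q.totalDegree ≤ c := by
  have : q.IsHomogeneous c := by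
    rw [← mem_homogeneousSubmodule]
    refine Submodule.span_le.2 ?_ hq
    rintro _ ⟨u, h1, h2, rfl⟩
    refine isHomogeneous_monomial _ ?_
    rw [wEdeg_eq] at h1
    rw [wGdeg_eq] at h2
    rw [Finsupp.degree_eq_sum, Fintype.sum_sum_type, h1, h2, zero_add]
  exact this.totalDegree_le

theorem Cz_dvd {i : Fin g} {q : SP K e g} (hq : q ∈ Cz K e g e)
    (hd : (X (Sum.inr i) : SP K e g) ^ e ∣ q) :
    q = C (coeff (Finsupp.single (Sum.inr i) e) q) * X (Sum.inr i) ^ e := by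
  obtain ⟨r, rfl⟩ := hd
  by_cases hr : r = 0
  · simp [hr]
  have h1 := Cz_totalDegree hq
  rw [totalDegree_mul_of_isDomain (pow_ne_zero _ (X_ne_zero _)) hr, totalDegree_X_pow] at h1
  have h2 : r.totalDegree = 0 := by omega
  rw [totalDegree_eq_zero_iff_eq_C] at h2
  rw [h2, mul_comm, coeff_C_mul, coeff_X_pow]
  simp

theorem dvd_main {x : NKos K e g}
    (hx : x ∈ DKos K e g 0 e (e * g - e)) (h0 : dN K e g x = 0) (i : Fin g) :
    (X (Sum.inr i) : SP K e g) ^ e ∣ DD (SP K e g) (Tf fun _ => i).toList x := by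
  by_cases hi : ∃ j : Fin g, j ≠ i
  · obtain ⟨j, hj⟩ := hi
    have h1 := DD_all hx h0 (fun _ => i) (fun _ => j)
    simp only [Finset.prod_const, Finset.card_univ, Fintype.card_fin] at h1
    have h2 := (Dvd.intro _ rfl : (X (Sum.inr i) : SP K e g) ^ e ∣ _).trans h1.symm.dvd
    refine X_prime.pow_dvd_of_dvd_mul_left e ?_ h2
    intro h3
    have h4 := X_prime.dvd_of_dvd_pow h3
    rw [X_dvd_X] at h4
    exact hj (Sum.inr_injective h4).symm
  · push Not at hi
    have hm : DD (SP K e g) (Tf fun _ => i).toList x ∈ Cz K e g e :=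
      DD_mem_Cz (by simpa [card_Tf] using hx)
    generalize DD (SP K e g) (Tf fun _ => i).toList x = q at hm
    unfold Cz at hm
    induction hm using Submodule.span_induction with
    | mem q h =>
      obtain ⟨u, h1, h2, rfl⟩ := h
      rw [wGdeg_eq, Finset.sum_eq_single i (by intro j _ hj; exact absurd (hi j) hj) (by simp)] at h2
      rw [X_pow_eq_monomial, monomial_one_dvd_monomial_one, Finsupp.single_le_iff, h2]
    | zero => exact dvd_zero _
    | add a b _ _ ha hb => exact dvd_add ha hb
    | smul a b _ hb => rw [smul_eq_C_mul]; exact hb.mul_left _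

end specific

theorem stmt_15 (K : Type) [Field K] (e g : ℕ) (he : 0 < e) (hg : 0 < g) :
    Module.finrank K
      ↥(DKos K e g 0 e (e * g - e) ⊓
          LinearMap.ker (LinearMap.restrictScalars K (dN K e g))) = 1 := by
  set i : Fin g := ⟨0, hg⟩
  obtain ⟨x, hx, h0, hxa⟩ := exists_elt (K := K) (e := e) i
  set φ : NKos K e g → SP K e g := fun y => DD (SP K e g) (Tf fun _ => i).toList y with hφ
  have key : ∀ y ∈ DKos K e g 0 e (e * g - e), dN K e g y = 0 →
      φ y = C (coeff (Finsupp.single (Sum.inr i) e) (φ y)) * X (Sum.inr i) ^ e := by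
    intro y hy hy0
    exact Cz_dvd (DD_mem_Cz (by simpa [card_Tf] using hy)) (dvd_main hy hy0 i)
  set cf : NKos K e g → K := fun y => coeff (Finsupp.single (Sum.inr i) e) (φ y) with hcf
  have hxne : φ x ≠ 0 := by
    intro h
    rw [hφ] at h
    simp only at h
    rw [h] at hxa
    exact pow_ne_zero e (X_ne_zero (R := K) (Sum.inr i)) (hxa.eq_zero_iff.1 rfl)
  have hcx : cf x ≠ 0 := by
    intro h
    apply hxne
    rw [key x hx h0]
    change C (cf x) * _ = 0
    rw [h, C_0, zero_mul]
  refine finrank_eq_one ⟨x, hx, ?_⟩ ?_ ?_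
  · exact h0
  · intro h
    apply hxne
    have : x = 0 := congrArg Subtype.val h
    rw [this, hφ]; simp
  · rintro ⟨w, hw, hw0⟩
    have hw0 : dN K e g w = 0 := hw0
    refine ⟨cf w / cf x, ?_⟩
    apply Subtype.ext
    change (cf w / cf x) • x = w
    rw [← sub_eq_zero]
    refine eq_zero_of_Tf hg (sub_mem (Submodule.smul_mem _ _ hx) hw) ?_ (fun _ => i) ?_
    · rw [← algebraMap_smul (SP K e g), map_sub, map_smul, h0, hw0]; simp
    · rw [← algebraMap_smul (SP K e g), map_sub, map_smul]
      change _ • φ x - φ w = 0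
      rw [key x hx h0, key w hw hw0]
      change _ • (C (cf x) * _) - C (cf w) * _ = 0
      rw [smul_eq_mul, algebraMap_eq, ← mul_assoc, ← C_mul, div_mul_cancel₀ _ hcx, sub_self]

end
end
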